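/- arXiv:1701.02774 — 4 statements merged into one kernel-verified Lean document; each statement's English description precedes it below -/
import Mathlib

section
/- If a clan γ' is obtained from a clan γ by one of the transpositions (T.1)–(T.10), then ℓ(γ) < ℓ(γ'). -/
noncomputable section
open scoped Classical

/-- A `(p,q)`-clan: a partial matching of `{0,…,p+q-1}` (encoded by the involution `mate`)
together with a sign (`true` = `+`, `false` = `-`) at each unmatched position, such that
`#(+) - #(-) = p - q`.  Matched positions carry the junk sign `true`. -/
structure Clan (p q : ℕ) where
  mate : Fin (p + q) → Fin (p + q)
  mate_invol : ∀ i, mate (mate i) = i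
  sign : Fin (p + q) → Bool
  sign_matched : ∀ i, mate i ≠ i → sign i = true
  plus_minus :
    (Finset.univ.filter fun i => mate i = i ∧ sign i = true).card + q
      = (Finset.univ.filter fun i => mate i = i ∧ sign i = false).card + p

namespace Clan

variable {p q r s : ℕ}

/-- position `i` carries a `+`. -/
def IsPlus (c : Clan p q) (i : Fin (p + q)) : Prop :=
  c.mate i = i ∧ c.sign i = true

/-- position `i` carries a `-`. -/
def IsMinus (c : Clan p q) (i : Fin (p + q)) : Prop :=
  c.mate i = i ∧ c.sign i = false

/-- position `i` is the left end of a matching. -/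
def IsLeft (c : Clan p q) (i : Fin (p + q)) : Prop :=
  i < c.mate i

/-- position `i` is the right end of a matching. -/
def IsRight (c : Clan p q) (i : Fin (p + q)) : Prop :=
  c.mate i < i

/-- `(i < j)` is a matching of the clan `c`. -/
def IsMatch (c : Clan p q) (i j : Fin (p + q)) : Prop :=
  i < j ∧ c.mate i = j

/-- The length `ℓ(c)` of a clan:
`ℓ(c) = Σ_{(i<j) matching} (j - i - #{matchings (s<t) with s < i < t < j})`. -/
def len (c : Clan p q) : ℤ :=
  ∑ ij ∈ Finset.univ.filter (fun ij : Fin (p + q) × Fin (p + q) => c.IsMatch ij.1 ij.2),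
    (((ij.2 : ℕ) : ℤ) - ((ij.1 : ℕ) : ℤ) -
      ((Finset.univ.filter (fun st : Fin (p + q) × Fin (p + q) =>
          c.IsMatch st.1 st.2 ∧ st.1 < ij.1 ∧ ij.1 < st.2 ∧ st.2 < ij.2)).card : ℤ))

/-- `c` and `c'` agree (same symbols, same matchings) at every position outside `S`. -/
def AgreeOutside (c c' : Clan p q) (S : Set (Fin (p + q))) : Prop :=
  ∀ i, i ∉ S → c.mate i = c'.mate i ∧ c.sign i = c'.sign i

/-- `c'` is obtained from `c` by one of the transpositions (T.1)–(T.10). -/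
def Transposition (c c' : Clan p q) : Prop :=
  -- (T.1)  +- ↦ 11
  (∃ a b, a < b ∧ c.IsPlus a ∧ c.IsMinus b ∧ c'.IsMatch a b ∧
      AgreeOutside c c' {a, b}) ∨
  -- (T.2)  -+ ↦ 11
  (∃ a b, a < b ∧ c.IsMinus a ∧ c.IsPlus b ∧ c'.IsMatch a b ∧
      AgreeOutside c c' {a, b}) ∨
  -- (T.3)  11+ ↦ 1+1
  (∃ a b d, c.IsMatch a b ∧ b < d ∧ c.IsPlus d ∧ c'.IsMatch a d ∧ c'.IsPlus b ∧
      AgreeOutside c c' {a, b, d}) ∨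
  -- (T.4)  11- ↦ 1-1
  (∃ a b d, c.IsMatch a b ∧ b < d ∧ c.IsMinus d ∧ c'.IsMatch a d ∧ c'.IsMinus b ∧
      AgreeOutside c c' {a, b, d}) ∨
  -- (T.5)  +11 ↦ 1+1
  (∃ a b d, c.IsPlus a ∧ a < b ∧ c.IsMatch b d ∧ c'.IsMatch a d ∧ c'.IsPlus b ∧
      AgreeOutside c c' {a, b, d}) ∨
  -- (T.6)  -11 ↦ 1-1
  (∃ a b d, c.IsMinus a ∧ a < b ∧ c.IsMatch b d ∧ c'.IsMatch a d ∧ c'.IsMinus b ∧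
      AgreeOutside c c' {a, b, d}) ∨
  -- (T.7)  1122 ↦ 1212
  (∃ i j k l, c.IsMatch i j ∧ j < k ∧ c.IsMatch k l ∧ c'.IsMatch i k ∧ c'.IsMatch j l ∧
      AgreeOutside c c' {i, j, k, l}) ∨
  -- (T.8)  1122 ↦ 1+-1
  (∃ i j k l, c.IsMatch i j ∧ j < k ∧ c.IsMatch k l ∧ c'.IsMatch i l ∧ c'.IsPlus j ∧
      c'.IsMinus k ∧ AgreeOutside c c' {i, j, k, l}) ∨
  -- (T.9)  1122 ↦ 1-+1
  (∃ i j k l, c.IsMatch i j ∧ j < k ∧ c.IsMatch k l ∧ c'.IsMatch i l ∧ c'.IsMinus j ∧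
      c'.IsPlus k ∧ AgreeOutside c c' {i, j, k, l}) ∨
  -- (T.10) 1212 ↦ 1221
  (∃ i j k l, i < j ∧ j < k ∧ k < l ∧ c.IsMatch i k ∧ c.IsMatch j l ∧ c'.IsMatch i l ∧
      c'.IsMatch j k ∧ AgreeOutside c c' {i, j, k, l})

/-- Bruhat order `≤` on clans: generated by transpositions. -/
def ble (c c' : Clan p q) : Prop :=
  Relation.ReflTransGen Transposition c c'

/-- Strict Bruhat order `<` on clans. -/
def blt (c c' : Clan p q) : Prop :=
  Relation.TransGen Transposition c c'

/-- Covering relation: `c ⋖ c'` iff `c < c'` and `ℓ(c') = ℓ(c) + 1`. -/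
def Covers (c c' : Clan p q) : Prop :=
  blt c c' ∧ c'.len = c.len + 1

/-- `θ` pattern contains `γ` via the strictly increasing index map `ι`. -/
def Pattern (θ : Clan r s) (γ : Clan p q) (ι : Fin (p + q) → Fin (r + s)) : Prop :=
  StrictMono ι ∧
  (∀ j, γ.mate j = j → θ.mate (ι j) = ι j ∧ θ.sign (ι j) = γ.sign j) ∧
  (∀ k l, γ.IsMatch k l → θ.IsMatch (ι k) (ι l))

/-- `φ` agrees with `θ` at every position outside the range of `ι`. -/
def AgreesWithOutside (φ θ : Clan r s) (ι : Fin (p + q) → Fin (r + s)) : Prop :=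
  ∀ m, (∀ k, ι k ≠ m) → φ.mate m = θ.mate m ∧ φ.sign m = θ.sign m

/-- `[α,γ]` interval pattern embeds into `[β,θ]` via `ι`. -/
def IntervalEmbed (α γ : Clan p q) (β θ : Clan r s)
    (ι : Fin (p + q) → Fin (r + s)) : Prop :=
  Pattern θ γ ι ∧ Pattern β α ι ∧ AgreesWithOutside β θ ι ∧
  θ.len - β.len = γ.len - α.len

/-- `θ` interval pattern contains `[α,γ]`. -/
def IntervalContains (θ : Clan r s) (α γ : Clan p q) : Prop :=
  ∃ (ι : Fin (p + q) → Fin (r + s)) (φ : Clan r s), IntervalEmbed α γ φ θ ι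

/-- `γ(i;+)` (here `i` is the number of initial positions considered, i.e. `i` is 1-indexed):
number of `+`'s plus number of matchings entirely among the first `i` positions. -/
def statPlus (c : Clan p q) (i : ℕ) : ℕ :=
  (Finset.univ.filter fun j : Fin (p + q) => (j : ℕ) < i ∧ c.IsPlus j).card +
  (Finset.univ.filter fun ab : Fin (p + q) × Fin (p + q) =>
      c.IsMatch ab.1 ab.2 ∧ (ab.2 : ℕ) < i).card

/-- `γ(i;-)`, as in `statPlus` with `-`'s. -/
def statMinus (c : Clan p q) (i : ℕ) : ℕ :=
  (Finset.univ.filter fun j : Fin (p + q) => (j : ℕ) < i ∧ c.IsMinus j).card +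
  (Finset.univ.filter fun ab : Fin (p + q) × Fin (p + q) =>
      c.IsMatch ab.1 ab.2 ∧ (ab.2 : ℕ) < i).card

/-- `γ(i;j)` (with `i < j` 1-indexed): number of matchings with left endpoint weakly left
of `i` and right endpoint strictly right of `j`. -/
def statMid (c : Clan p q) (i j : ℕ) : ℕ :=
  (Finset.univ.filter fun ab : Fin (p + q) × Fin (p + q) =>
      c.IsMatch ab.1 ab.2 ∧ (ab.1 : ℕ) < i ∧ j ≤ (ab.2 : ℕ)).card

/-- The permutation `w_c` associated to a clan `c`, 0-indexed: positions carrying a `+` or a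
left endpoint get (in left-to-right order) the values `0,…,p-1`; the remaining values
`p,…,p+q-1` are assigned, scanning left to right, to each `-` as it is encountered and to the
right end of each matching as soon as its left end is encountered. -/
def wNat (c : Clan p q) (i : Fin (p + q)) : ℕ :=
  if c.IsPlus i ∨ c.IsLeft i then
    (Finset.univ.filter fun j : Fin (p + q) => (c.IsPlus j ∨ c.IsLeft j) ∧ j < i).card
  else
    p + (Finset.univ.filter fun j : Fin (p + q) =>
        (c.IsMinus j ∨ c.IsLeft j) ∧ j < (if c.IsMinus i then i else c.mate i)).card

/-- Membership in the affine space `S_c`: the conditions (O.1)–(O.3) and (Z.1)–(Z.9). -/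
def MemS (c : Clan p q) (M : Matrix (Fin (p + q)) (Fin (p + q)) ℂ) : Prop :=
  -- (O.1)
  (∀ i j : Fin (p + q), c.mate i = i → (j : ℕ) = c.wNat i → M i j = 1) ∧
  -- (O.2)
  (∀ i i' j : Fin (p + q), c.IsMatch i i' →
      ((j : ℕ) = c.wNat i ∨ (j : ℕ) = c.wNat i') → M i j = 1) ∧
  -- (O.3)
  (∀ i i' j : Fin (p + q), c.IsMatch i i' → (j : ℕ) = c.wNat i → M i' j = -1) ∧
  (∀ i i' j : Fin (p + q), c.IsMatch i i' → (j : ℕ) = c.wNat i' → M i' j = 1) ∧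
  -- (Z.1): first p columns, rows containing a pivot (rows of +'s and of left endpoints)
  (∀ i j : Fin (p + q), (c.IsPlus i ∨ c.IsLeft i) → (j : ℕ) < p →
      (j : ℕ) ≠ c.wNat i → M i j = 0) ∧
  -- (Z.2): above a pivot, first p columns
  (∀ i x j : Fin (p + q), (c.IsPlus i ∨ c.IsLeft i) → (j : ℕ) = c.wNat i →
      x < i → M x j = 0) ∧
  -- (Z.3): between the pivot 1 and the -1 of a column
  (∀ i i' x j : Fin (p + q), c.IsMatch i i' → (j : ℕ) = c.wNat i →
      i < x → x < i' → M x j = 0) ∧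
  -- (Z.4): right of a -1, within the first p columns
  (∀ i i' j : Fin (p + q), c.IsMatch i i' → c.wNat i < (j : ℕ) → (j : ℕ) < p →
      M i' j = 0) ∧
  -- (Z.5): last q columns, rows containing a pivot (rows of -'s and of left endpoints)
  (∀ i j : Fin (p + q), c.IsMinus i → p ≤ (j : ℕ) → (j : ℕ) ≠ c.wNat i → M i j = 0) ∧
  (∀ i i' j : Fin (p + q), c.IsMatch i i' → p ≤ (j : ℕ) → (j : ℕ) ≠ c.wNat i' →
      M i j = 0) ∧
  -- (Z.6): above a pivot, last q columns
  (∀ i x j : Fin (p + q), c.IsMinus i → (j : ℕ) = c.wNat i → x < i → M x j = 0) ∧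
  (∀ i i' x j : Fin (p + q), c.IsMatch i i' → (j : ℕ) = c.wNat i' → x < i → M x j = 0) ∧
  -- (Z.7): between the pivot 1 and the second 1 of a column
  (∀ i i' x j : Fin (p + q), c.IsMatch i i' → (j : ℕ) = c.wNat i' →
      i < x → x < i' → M x j = 0) ∧
  -- (Z.8): right of a second-1-of-its-column
  (∀ i i' j : Fin (p + q), c.IsMatch i i' → c.wNat i' < (j : ℕ) → M i' j = 0) ∧
  -- (Z.9): identification for 1212 patterns
  (∀ i j k l ci ck : Fin (p + q), c.IsMatch i k → c.IsMatch j l →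
      i < j → j < k → k < l → (ci : ℕ) = c.wNat i → (ck : ℕ) = c.wNat k →
      M l ck = - M l ci)

/-- Rank of the southwest `(n-i) × p` submatrix of `M` (`i` 1-indexed from `1` to `n`). -/
def swRank (p q : ℕ) (M : Matrix (Fin (p + q)) (Fin (p + q)) ℂ) (i : ℕ) : ℕ :=
  Matrix.rank (Matrix.of fun (x : Fin (p + q - i)) (y : Fin p) =>
    M ⟨i + (x : ℕ), by have := x.isLt; omega⟩ ⟨(y : ℕ), by have := y.isLt; omega⟩)

/-- Rank of the southeast `(n-i) × q` submatrix of `M`. -/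
def seRank (p q : ℕ) (M : Matrix (Fin (p + q)) (Fin (p + q)) ℂ) (i : ℕ) : ℕ :=
  Matrix.rank (Matrix.of fun (x : Fin (p + q - i)) (y : Fin q) =>
    M ⟨i + (x : ℕ), by have := x.isLt; omega⟩ ⟨p + (y : ℕ), by have := y.isLt; omega⟩)

/-- Rank of the auxiliary matrix `M^{[i;j]}`: its first `i` columns are the first `i` columns
of `M⁻¹` with the last `q` rows zeroed out, its last `j` columns are the first `j` columns
of `M⁻¹`. -/
def auxRank (p q : ℕ) (M : Matrix (Fin (p + q)) (Fin (p + q)) ℂ) (i j : ℕ) : ℕ :=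
  Matrix.rank (Matrix.of fun (x : Fin (p + q)) (y : Fin i ⊕ Fin j) =>
    Sum.elim
      (fun a : Fin i =>
        if p ≤ (x : ℕ) then (0 : ℂ)
        else if h : (a : ℕ) < p + q then M⁻¹ x ⟨(a : ℕ), h⟩ else 0)
      (fun b : Fin j =>
        if h : (b : ℕ) < p + q then M⁻¹ x ⟨(b : ℕ), h⟩ else 0) y)

/-- The Mars–Springer variety `N_{θ,c}`: matrices of `S_c` satisfying the rank
conditions (R.1)–(R.3) attached to `θ`. -/
def MarsSpringer (θ c : Clan p q) (M : Matrix (Fin (p + q)) (Fin (p + q)) ℂ) : Prop :=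
  MemS c M ∧
  (∀ i : ℕ, 1 ≤ i → i ≤ p + q → swRank p q M i ≤ p - statPlus θ i) ∧
  (∀ i : ℕ, 1 ≤ i → i ≤ p + q → seRank p q M i ≤ q - statMinus θ i) ∧
  (∀ i j : ℕ, 1 ≤ i → i < j → j ≤ p + q → auxRank p q M i j ≤ j + statMid θ i j)

/-- The linear relations defining the coordinates `λ_{k,a}`:
`e_k + Σ_{a ≥ p} λ_{k,a} v_a = Σ_{a < p} λ_{k,a} v_a`, where `v_a` are the columns of `M`. -/
def LambdaRel (p q : ℕ) (M : Matrix (Fin (p + q)) (Fin (p + q)) ℂ)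
    (lam : Fin (p + q) → Fin (p + q) → ℂ) : Prop :=
  ∀ k x : Fin (p + q),
    (if x = k then (1 : ℂ) else 0) +
        ∑ a ∈ Finset.univ.filter (fun a : Fin (p + q) => p ≤ (a : ℕ)), lam k a * M x a
      = ∑ a ∈ Finset.univ.filter (fun a : Fin (p + q) => (a : ℕ) < p), lam k a * M x a

/-- The base point of `S_c`: all free entries set to `0`. -/
def basePoint (c : Clan p q) : Matrix (Fin (p + q)) (Fin (p + q)) ℂ :=
  Matrix.of fun i j =>
    if (j : ℕ) = c.wNat i then 1
    else if c.mate i ≠ i ∧ (j : ℕ) = c.wNat (c.mate i) then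
      (if c.mate i < i then -1 else 1)
    else 0

/-- The diagonal matrix `I_{p,q}` with `p` ones followed by `q` negative ones. -/
def Ipq (p q : ℕ) : Matrix (Fin (p + q)) (Fin (p + q)) ℂ :=
  Matrix.diagonal fun i => if (i : ℕ) < p then 1 else -1

end Clan

/-- The indicator of `i < x ≤ m i` and `i ≤ m x`.  Summed over all pairs it gives the length
of the clan with involution `m`: a right end `x` in `(i, m i]` with `m x < i` is a crossing. -/
def reach {n : ℕ} (m : Fin n → Fin n) (i x : Fin n) : ℤ :=
  if i < x ∧ x ≤ m i ∧ i ≤ m x then 1 else 0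

theorem sum_reach_eq {n : ℕ} (m : Fin n → Fin n) (i : Fin n) (hi : i < m i) :
    ∑ x, reach m i x = ((m i : ℕ) : ℤ) - ((i : ℕ) : ℤ) -
      ((Finset.univ.filter fun x => i < x ∧ x ≤ m i ∧ m x < i).card : ℤ) := by
  have hcard := Finset.card_filter_add_card_filter_not (s := Finset.Ioc i (m i)) (fun x => m x < i)
  rw [Fin.card_Ioc] at hcard
  have h₁ : (Finset.Ioc i (m i)).filter (fun x => m x < i) =
      Finset.univ.filter fun x => i < x ∧ x ≤ m i ∧ m x < i := by
    ext x; simp [and_assoc]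
  have h₂ : (Finset.Ioc i (m i)).filter (fun x => ¬ m x < i) =
      Finset.univ.filter fun x => i < x ∧ x ≤ m i ∧ i ≤ m x := by
    ext x; simp [and_assoc]
  rw [h₁, h₂] at hcard
  simp only [reach, Finset.sum_boole]
  have : (i : ℕ) < m i := hi
  omega

theorem sum_reach_eq_zero {n : ℕ} (m : Fin n → Fin n) (i : Fin n) (hi : ¬ i < m i) :
    ∑ x, reach m i x = 0 :=
  Finset.sum_eq_zero fun _ _ => if_neg fun h => hi (h.1.trans_le h.2.1)

/-- A double sum split along a subset `S` of the indices. -/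
theorem sum_sum_eq_of_finset {n : ℕ} (f : Fin n → Fin n → ℤ) (S : Finset (Fin n)) :
    ∑ i, ∑ x, f i x = ∑ i ∈ S, ∑ x ∈ S, f i x + ∑ i ∈ Sᶜ, ∑ x ∈ Sᶜ, f i x +
      ∑ x ∈ Sᶜ, ∑ s ∈ S, (f s x + f x s) := by
  simp only [← Finset.sum_add_sum_compl S, Finset.sum_add_distrib]
  rw [Finset.sum_comm (s := S) (t := Sᶜ)]
  ring

namespace Clan

/-- The matchings crossing `(i < mate i)` from the left are counted by their right ends. -/
theorem card_crossing {p q : ℕ} (c : Clan p q) (i : Fin (p + q)) :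
    (Finset.univ.filter fun st : Fin (p + q) × Fin (p + q) =>
      c.IsMatch st.1 st.2 ∧ st.1 < i ∧ i < st.2 ∧ st.2 < c.mate i).card =
    (Finset.univ.filter fun x => i < x ∧ x ≤ c.mate i ∧ c.mate x < i).card := by
  refine Finset.card_bij' (fun st _ => st.2) (fun x _ => (c.mate x, x)) ?_ ?_ ?_ ?_
  · rintro ⟨s, t⟩ h
    rw [Finset.mem_filter] at h ⊢
    obtain ⟨-, ⟨-, hst⟩, h₁, h₂, h₃⟩ := h
    exact ⟨Finset.mem_univ _, h₂, h₃.le, by rwa [← hst, c.mate_invol]⟩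
  · intro x h
    rw [Finset.mem_filter] at h ⊢
    obtain ⟨-, h⟩ := h
    refine ⟨Finset.mem_univ _, ⟨h.2.2.trans h.1, c.mate_invol x⟩, h.2.2, h.1,
      lt_of_le_of_ne h.2.1 ?_⟩
    rintro rfl
    exact (c.mate_invol i ▸ h.2.2).false
  · rintro ⟨s, t⟩ h
    obtain ⟨-, ⟨-, hst⟩, -⟩ := Finset.mem_filter.1 h
    exact Prod.ext (by rw [← hst]; exact c.mate_invol s) rfl
  · intro x _
    rfl

theorem len_eq_sum_reach {p q : ℕ} (c : Clan p q) :
    c.len = ∑ i, ∑ x, reach c.mate i x := by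
  rw [len, Finset.sum_filter, Fintype.sum_prod_type]
  refine Finset.sum_congr rfl fun i _ => ?_
  by_cases hi : i < c.mate i
  · rw [sum_reach_eq _ _ hi, Finset.sum_eq_single (c.mate i)]
    · rw [if_pos ⟨hi, rfl⟩, ← card_crossing]
    · exact fun j _ hj => if_neg fun h => hj h.2.symm
    · simp
  · rw [sum_reach_eq_zero _ _ hi]
    exact Finset.sum_eq_zero fun j _ => if_neg fun h : c.IsMatch i j => hi (h.2 ▸ h.1)

/-- Changing an involution on an invariant set `S` increases the length as soon as the
contribution of `S` itself increases and no outside position loses. -/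
theorem len_lt_len {p q : ℕ} {c c' : Clan p q} (S : Finset (Fin (p + q)))
    (hS : ∀ s ∈ S, c.mate s ∈ S) (hagree : c.AgreeOutside c' S)
    (hin : ∑ i ∈ S, ∑ x ∈ S, reach c.mate i x < ∑ i ∈ S, ∑ x ∈ S, reach c'.mate i x)
    (hout : ∀ x ∉ S, c.mate x ∉ S → c.mate x = c'.mate x →
      ∑ s ∈ S, (reach c.mate s x + reach c.mate x s) ≤
        ∑ s ∈ S, (reach c'.mate s x + reach c'.mate x s)) :
    c.len < c'.len := by
  rw [len_eq_sum_reach, len_eq_sum_reach, sum_sum_eq_of_finset _ S,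
    sum_sum_eq_of_finset (reach c'.mate) S]
  have hmate (x) (hx : x ∉ S) : c.mate x = c'.mate x := (hagree x (by simpa using hx)).1
  have hcompl : ∑ i ∈ Sᶜ, ∑ x ∈ Sᶜ, reach c.mate i x =
      ∑ i ∈ Sᶜ, ∑ x ∈ Sᶜ, reach c'.mate i x := by
    refine Finset.sum_congr rfl fun i hi => Finset.sum_congr rfl fun x hx => ?_
    rw [reach, reach, hmate i (by simpa using hi), hmate x (by simpa using hx)]
  have hmixed : ∑ x ∈ Sᶜ, ∑ s ∈ S, (reach c.mate s x + reach c.mate x s) ≤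
      ∑ x ∈ Sᶜ, ∑ s ∈ S, (reach c'.mate s x + reach c'.mate x s) := by
    refine Finset.sum_le_sum fun x hx => ?_
    have hx : x ∉ S := by simpa using hx
    exact hout x hx (fun h => hx (c.mate_invol x ▸ hS _ h)) (hmate x hx)
  linarith

/-- Two unmatched positions `a < b` become matched. -/
theorem len_lt_len_of_join_fixed {p q : ℕ} {c c' : Clan p q} {a b : Fin (p + q)}
    (hab : a < b)
    (ha : c.mate a = a) (hb : c.mate b = b)
    (ha' : c'.mate a = b)
    (hagree : c.AgreeOutside c' {a, b}) : c.len < c'.len := by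
  have hb' : c'.mate b = a := ha' ▸ c'.mate_invol a
  have h₁ : a ∉ ({b} : Finset (Fin (p + q))) := by simp; omega
  refine len_lt_len {a, b} (by simp [ha, hb]) (by simpa using hagree) ?_
    fun x hx hy hxy => ?_
  · simp only [Finset.sum_insert h₁, Finset.sum_singleton, reach,
      ha, hb, ha', hb', Fin.lt_def, Fin.le_def] at hab ⊢
    simp (disch := omega) only [if_pos, if_neg]
    norm_num
  · simp only [Finset.mem_insert, Finset.mem_singleton, not_or, Fin.ext_iff] at hx hy
    simp only [Finset.sum_insert h₁, Finset.sum_singleton, reach,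
      ha, hb, ha', hb',
      ← hxy, Fin.lt_def, Fin.le_def] at hab ⊢
    generalize c.mate x = y at hy ⊢
    have hx : x.1 < a ∨ (a.1 < x ∧ x.1 < b) ∨ b.1 < x := by
      omega
    have hy : y.1 < a ∨ (a.1 < y ∧ y.1 < b) ∨ b.1 < y := by
      omega
    rcases hx with hx | hx | hx <;>
      rcases hy with hy | hy | hy <;>
        simp (disch := omega) only [if_pos, if_neg] <;> norm_num

/-- The matching `(a < b)` is extended to the right. -/
theorem len_lt_len_of_extend_right {p q : ℕ} {c c' : Clan p q} {a b d : Fin (p + q)}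
    (hab : a < b) (hbd : b < d)
    (ha : c.mate a = b) (hd : c.mate d = d)
    (ha' : c'.mate a = d) (hb' : c'.mate b = b)
    (hagree : c.AgreeOutside c' {a, b, d}) : c.len < c'.len := by
  have hb : c.mate b = a := ha ▸ c.mate_invol a
  have hd' : c'.mate d = a := ha' ▸ c'.mate_invol a
  have h₁ : a ∉ ({b, d} : Finset (Fin (p + q))) := by simp; omega
  have h₂ : b ∉ ({d} : Finset (Fin (p + q))) := by simp; omega
  refine len_lt_len {a, b, d} (by simp [ha, hb, hd]) (by simpa using hagree) ?_
    fun x hx hy hxy => ?_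
  · simp only [Finset.sum_insert h₁, Finset.sum_insert h₂, Finset.sum_singleton, reach,
      ha, hb, hd, ha', hb', hd', Fin.lt_def, Fin.le_def] at hab hbd ⊢
    simp (disch := omega) only [if_pos, if_neg]
    norm_num
  · simp only [Finset.mem_insert, Finset.mem_singleton, not_or, Fin.ext_iff] at hx hy
    simp only [Finset.sum_insert h₁, Finset.sum_insert h₂, Finset.sum_singleton, reach,
      ha, hb, hd, ha', hb', hd',
      ← hxy, Fin.lt_def, Fin.le_def] at hab hbd ⊢
    generalize c.mate x = y at hy ⊢
    have hx : x.1 < a ∨ (a.1 < x ∧ x.1 < b) ∨ (b.1 < x ∧ x.1 < d) ∨ d.1 < x := by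
      omega
    have hy : y.1 < a ∨ (a.1 < y ∧ y.1 < b) ∨ (b.1 < y ∧ y.1 < d) ∨ d.1 < y := by
      omega
    rcases hx with hx | hx | hx | hx <;>
      rcases hy with hy | hy | hy | hy <;>
        simp (disch := omega) only [if_pos, if_neg] <;> norm_num

/-- The matching `(b < d)` is extended to the left. -/
theorem len_lt_len_of_extend_left {p q : ℕ} {c c' : Clan p q} {a b d : Fin (p + q)}
    (hab : a < b) (hbd : b < d)
    (ha : c.mate a = a) (hb : c.mate b = d)
    (ha' : c'.mate a = d) (hb' : c'.mate b = b)
    (hagree : c.AgreeOutside c' {a, b, d}) : c.len < c'.len := by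
  have hd : c.mate d = b := hb ▸ c.mate_invol b
  have hd' : c'.mate d = a := ha' ▸ c'.mate_invol a
  have h₁ : a ∉ ({b, d} : Finset (Fin (p + q))) := by simp; omega
  have h₂ : b ∉ ({d} : Finset (Fin (p + q))) := by simp; omega
  refine len_lt_len {a, b, d} (by simp [ha, hb, hd]) (by simpa using hagree) ?_
    fun x hx hy hxy => ?_
  · simp only [Finset.sum_insert h₁, Finset.sum_insert h₂, Finset.sum_singleton, reach,
      ha, hb, hd, ha', hb', hd', Fin.lt_def, Fin.le_def] at hab hbd ⊢
    simp (disch := omega) only [if_pos, if_neg]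
    norm_num
  · simp only [Finset.mem_insert, Finset.mem_singleton, not_or, Fin.ext_iff] at hx hy
    simp only [Finset.sum_insert h₁, Finset.sum_insert h₂, Finset.sum_singleton, reach,
      ha, hb, hd, ha', hb', hd',
      ← hxy, Fin.lt_def, Fin.le_def] at hab hbd ⊢
    generalize c.mate x = y at hy ⊢
    have hx : x.1 < a ∨ (a.1 < x ∧ x.1 < b) ∨ (b.1 < x ∧ x.1 < d) ∨ d.1 < x := by
      omega
    have hy : y.1 < a ∨ (a.1 < y ∧ y.1 < b) ∨ (b.1 < y ∧ y.1 < d) ∨ d.1 < y := by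
      omega
    rcases hx with hx | hx | hx | hx <;>
      rcases hy with hy | hy | hy | hy <;>
        simp (disch := omega) only [if_pos, if_neg] <;> norm_num

/-- Two disjoint matchings become crossing. -/
theorem len_lt_len_of_cross {p q : ℕ} {c c' : Clan p q} {i j k l : Fin (p + q)}
    (hij : i < j) (hjk : j < k) (hkl : k < l)
    (hi : c.mate i = j) (hk : c.mate k = l)
    (hi' : c'.mate i = k) (hj' : c'.mate j = l)
    (hagree : c.AgreeOutside c' {i, j, k, l}) : c.len < c'.len := by
  have hj : c.mate j = i := hi ▸ c.mate_invol i
  have hl : c.mate l = k := hk ▸ c.mate_invol k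
  have hk' : c'.mate k = i := hi' ▸ c'.mate_invol i
  have hl' : c'.mate l = j := hj' ▸ c'.mate_invol j
  have h₁ : i ∉ ({j, k, l} : Finset (Fin (p + q))) := by simp; omega
  have h₂ : j ∉ ({k, l} : Finset (Fin (p + q))) := by simp; omega
  have h₃ : k ∉ ({l} : Finset (Fin (p + q))) := by simp; omega
  refine len_lt_len {i, j, k, l} (by simp [hi, hj, hk, hl]) (by simpa using hagree) ?_
    fun x hx hy hxy => ?_
  · simp only [Finset.sum_insert h₁, Finset.sum_insert h₂, Finset.sum_insert h₃,
      Finset.sum_singleton, reach, hi, hj, hk, hl, hi', hj', hk', hl',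
      Fin.lt_def, Fin.le_def] at hij hjk hkl ⊢
    simp (disch := omega) only [if_pos, if_neg]
    norm_num
  · simp only [Finset.mem_insert, Finset.mem_singleton, not_or, Fin.ext_iff] at hx hy
    simp only [Finset.sum_insert h₁, Finset.sum_insert h₂, Finset.sum_insert h₃,
      Finset.sum_singleton, reach, hi, hj, hk, hl, hi', hj', hk', hl',
      ← hxy, Fin.lt_def, Fin.le_def] at hij hjk hkl ⊢
    generalize c.mate x = y at hy ⊢
    have hx : x.1 < i ∨ (i.1 < x ∧ x.1 < j) ∨ (j.1 < x ∧ x.1 < k) ∨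
        (k.1 < x ∧ x.1 < l) ∨ l.1 < x := by omega
    have hy : y.1 < i ∨ (i.1 < y ∧ y.1 < j) ∨ (j.1 < y ∧ y.1 < k) ∨
        (k.1 < y ∧ y.1 < l) ∨ l.1 < y := by omega
    rcases hx with hx | hx | hx | hx | hx <;>
      rcases hy with hy | hy | hy | hy | hy <;>
        simp (disch := omega) only [if_pos, if_neg] <;> norm_num

/-- Two disjoint matchings merge into one joining their outer ends. -/
theorem len_lt_len_of_merge {p q : ℕ} {c c' : Clan p q} {i j k l : Fin (p + q)}
    (hij : i < j) (hjk : j < k) (hkl : k < l)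
    (hi : c.mate i = j) (hk : c.mate k = l)
    (hi' : c'.mate i = l) (hj' : c'.mate j = j) (hk' : c'.mate k = k)
    (hagree : c.AgreeOutside c' {i, j, k, l}) : c.len < c'.len := by
  have hj : c.mate j = i := hi ▸ c.mate_invol i
  have hl : c.mate l = k := hk ▸ c.mate_invol k
  have hl' : c'.mate l = i := hi' ▸ c'.mate_invol i
  have h₁ : i ∉ ({j, k, l} : Finset (Fin (p + q))) := by simp; omega
  have h₂ : j ∉ ({k, l} : Finset (Fin (p + q))) := by simp; omega
  have h₃ : k ∉ ({l} : Finset (Fin (p + q))) := by simp; omega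
  refine len_lt_len {i, j, k, l} (by simp [hi, hj, hk, hl]) (by simpa using hagree) ?_
    fun x hx hy hxy => ?_
  · simp only [Finset.sum_insert h₁, Finset.sum_insert h₂, Finset.sum_insert h₃,
      Finset.sum_singleton, reach, hi, hj, hk, hl, hi', hj', hk', hl',
      Fin.lt_def, Fin.le_def] at hij hjk hkl ⊢
    simp (disch := omega) only [if_pos, if_neg]
    norm_num
  · simp only [Finset.mem_insert, Finset.mem_singleton, not_or, Fin.ext_iff] at hx hy
    simp only [Finset.sum_insert h₁, Finset.sum_insert h₂, Finset.sum_insert h₃,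
      Finset.sum_singleton, reach, hi, hj, hk, hl, hi', hj', hk', hl',
      ← hxy, Fin.lt_def, Fin.le_def] at hij hjk hkl ⊢
    generalize c.mate x = y at hy ⊢
    have hx : x.1 < i ∨ (i.1 < x ∧ x.1 < j) ∨ (j.1 < x ∧ x.1 < k) ∨
        (k.1 < x ∧ x.1 < l) ∨ l.1 < x := by omega
    have hy : y.1 < i ∨ (i.1 < y ∧ y.1 < j) ∨ (j.1 < y ∧ y.1 < k) ∨
        (k.1 < y ∧ y.1 < l) ∨ l.1 < y := by omega
    rcases hx with hx | hx | hx | hx | hx <;>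
      rcases hy with hy | hy | hy | hy | hy <;>
        simp (disch := omega) only [if_pos, if_neg] <;> norm_num

/-- Two crossing matchings become nested. -/
theorem len_lt_len_of_nest {p q : ℕ} {c c' : Clan p q} {i j k l : Fin (p + q)}
    (hij : i < j) (hjk : j < k) (hkl : k < l)
    (hi : c.mate i = k) (hj : c.mate j = l)
    (hi' : c'.mate i = l) (hj' : c'.mate j = k)
    (hagree : c.AgreeOutside c' {i, j, k, l}) : c.len < c'.len := by
  have hk : c.mate k = i := hi ▸ c.mate_invol i
  have hl : c.mate l = j := hj ▸ c.mate_invol j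
  have hk' : c'.mate k = j := hj' ▸ c'.mate_invol j
  have hl' : c'.mate l = i := hi' ▸ c'.mate_invol i
  have h₁ : i ∉ ({j, k, l} : Finset (Fin (p + q))) := by simp; omega
  have h₂ : j ∉ ({k, l} : Finset (Fin (p + q))) := by simp; omega
  have h₃ : k ∉ ({l} : Finset (Fin (p + q))) := by simp; omega
  refine len_lt_len {i, j, k, l} (by simp [hi, hj, hk, hl]) (by simpa using hagree) ?_
    fun x hx hy hxy => ?_
  · simp only [Finset.sum_insert h₁, Finset.sum_insert h₂, Finset.sum_insert h₃,
      Finset.sum_singleton, reach, hi, hj, hk, hl, hi', hj', hk', hl',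
      Fin.lt_def, Fin.le_def] at hij hjk hkl ⊢
    simp (disch := omega) only [if_pos, if_neg]
    norm_num
  · simp only [Finset.mem_insert, Finset.mem_singleton, not_or, Fin.ext_iff] at hx hy
    simp only [Finset.sum_insert h₁, Finset.sum_insert h₂, Finset.sum_insert h₃,
      Finset.sum_singleton, reach, hi, hj, hk, hl, hi', hj', hk', hl',
      ← hxy, Fin.lt_def, Fin.le_def] at hij hjk hkl ⊢
    generalize c.mate x = y at hy ⊢
    have hx : x.1 < i ∨ (i.1 < x ∧ x.1 < j) ∨ (j.1 < x ∧ x.1 < k) ∨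
        (k.1 < x ∧ x.1 < l) ∨ l.1 < x := by omega
    have hy : y.1 < i ∨ (i.1 < y ∧ y.1 < j) ∨ (j.1 < y ∧ y.1 < k) ∨
        (k.1 < y ∧ y.1 < l) ∨ l.1 < y := by omega
    rcases hx with hx | hx | hx | hx | hx <;>
      rcases hy with hy | hy | hy | hy | hy <;>
        simp (disch := omega) only [if_pos, if_neg] <;> norm_num

end Clan

/-- every transposition (T.1)-(T.10) strictly increases length. -/
theorem transposition_increases_len {p q : ℕ} (c c' : Clan p q)
    (h : Clan.Transposition c c') : c.len < c'.len := by
  rcases h with ⟨a, b, hab, ha, hb, ha', hS⟩ | ⟨a, b, hab, ha, hb, ha', hS⟩ |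
    ⟨a, b, d, ha, hbd, hd, ha', hb', hS⟩ | ⟨a, b, d, ha, hbd, hd, ha', hb', hS⟩ |
    ⟨a, b, d, ha, hab, hb, ha', hb', hS⟩ | ⟨a, b, d, ha, hab, hb, ha', hb', hS⟩ |
    ⟨i, j, k, l, hi, hjk, hk, hi', hj', hS⟩ | ⟨i, j, k, l, hi, hjk, hk, hi', hj', hk', hS⟩ |
    ⟨i, j, k, l, hi, hjk, hk, hi', hj', hk', hS⟩ |
    ⟨i, j, k, l, hij, hjk, hkl, hi, hj, hi', hj', hS⟩
  · exact Clan.len_lt_len_of_join_fixed hab ha.1 hb.1 ha'.2 hS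
  · exact Clan.len_lt_len_of_join_fixed hab ha.1 hb.1 ha'.2 hS
  · exact Clan.len_lt_len_of_extend_right ha.1 hbd ha.2 hd.1 ha'.2 hb'.1 hS
  · exact Clan.len_lt_len_of_extend_right ha.1 hbd ha.2 hd.1 ha'.2 hb'.1 hS
  · exact Clan.len_lt_len_of_extend_left hab hb.1 ha.1 hb.2 ha'.2 hb'.1 hS
  · exact Clan.len_lt_len_of_extend_left hab hb.1 ha.1 hb.2 ha'.2 hb'.1 hS
  · exact Clan.len_lt_len_of_cross hi.1 hjk hk.1 hi.2 hk.2 hi'.2 hj'.2 hS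
  · exact Clan.len_lt_len_of_merge hi.1 hjk hk.1 hi.2 hk.2 hi'.2 hj'.1 hk'.1 hS
  · exact Clan.len_lt_len_of_merge hi.1 hjk hk.1 hi.2 hk.2 hi'.2 hj'.1 hk'.1 hS
  · exact Clan.len_lt_len_of_nest hij hjk hkl hi.2 hj.2 hi'.2 hj'.2 hS
end
end

section
/- Suppose γ' is obtained from γ by the transposition (T.7) applied at positions i<j<k<ℓ, i.e., the matchings (i<j) and (k<ℓ) of γ are replaced by the matchings (i<k) and (j<ℓ), all other symbols unchanged. Then ℓ(γ') − ℓ(γ) = 2(k−j) − 1 − 2·( #{matchings (a<b) of γ with a<i<j<b<k<ℓ} + #{matchings (a<b) of γ with i<j<a<k<ℓ<b} ). -/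
noncomputable section
open scoped Classical

namespace Clan

variable {p q : ℕ}

/-- The set of matchings of a clan, as pairs `(i, j)` with `i < j`. -/
def arcs (c : Clan p q) : Finset (Fin (p + q) × Fin (p + q)) :=
  Finset.univ.filter fun x => c.IsMatch x.1 x.2

/-- The indicator that `y` starts before `x` and the two arcs cross. -/
def crossing (y x : Fin (p + q) × Fin (p + q)) : ℤ :=
  if y.1 < x.1 ∧ x.1 < y.2 ∧ y.2 < x.2 then 1 else 0

theorem mem_arcs {c : Clan p q} {x : Fin (p + q) × Fin (p + q)} :
    x ∈ c.arcs ↔ c.IsMatch x.1 x.2 := by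
  simp [arcs]

theorem IsMatch.mate_right {c : Clan p q} {i j : Fin (p + q)} (h : c.IsMatch i j) :
    c.mate j = i := by
  rw [← h.2, c.mate_invol]

theorem card_filter_isMatch_and (c : Clan p q) (P : Fin (p + q) × Fin (p + q) → Prop)
    [DecidablePred P] {_ : DecidablePred fun x => c.IsMatch x.1 x.2 ∧ P x} :
    ((Finset.univ.filter fun x => c.IsMatch x.1 x.2 ∧ P x).card : ℤ) =
      ∑ x ∈ c.arcs, if P x then 1 else 0 := by
  rw [← Finset.natCast_card_filter, arcs, Finset.filter_filter]
  congr!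

theorem len_eq_sum_arcs (c : Clan p q) :
    c.len = ∑ x ∈ c.arcs,
      (((x.2 : ℕ) : ℤ) - ((x.1 : ℕ) : ℤ) - ∑ y ∈ c.arcs, crossing y x) := by
  refine Finset.sum_congr rfl fun x _ => ?_
  rw [c.card_filter_isMatch_and fun y => y.1 < x.1 ∧ x.1 < y.2 ∧ y.2 < x.2]
  rfl

/-- The arcs of `c` whose left end is neither `i` nor `k`. -/
def otherArcs (c : Clan p q) (i k : Fin (p + q)) : Finset (Fin (p + q) × Fin (p + q)) :=
  c.arcs.filter fun x => x.1 ≠ i ∧ x.1 ≠ k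

theorem arcs_eq_insert {c : Clan p q} {i j k l : Fin (p + q)}
    (hij : c.IsMatch i j) (hkl : c.IsMatch k l) :
    c.arcs = insert (i, j) (insert (k, l) (c.otherArcs i k)) := by
  ext ⟨a, b⟩
  simp only [otherArcs, mem_arcs, Finset.mem_insert, Finset.mem_filter, Prod.mk.injEq]
  have := hij.2
  have := hkl.2
  constructor
  · intro h
    have := h.2
    grind
  · rintro (⟨rfl, rfl⟩ | ⟨rfl, rfl⟩ | h)
    exacts [hij, hkl, h.1]

/-- Summing `weight - crossings` over a set of arcs enlarged by two arcs. -/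
theorem sum_insert_insert {R : Finset (Fin (p + q) × Fin (p + q))}
    {a b : Fin (p + q) × Fin (p + q)} (ha : a ∉ insert b R) (hb : b ∉ R)
    (w : Fin (p + q) × Fin (p + q) → ℤ) :
    ∑ x ∈ insert a (insert b R), (w x - ∑ y ∈ insert a (insert b R), crossing y x) =
      (∑ x ∈ R, (w x - ∑ y ∈ R, crossing y x)) + w a + w b
        - crossing a b - crossing b a
        - ∑ x ∈ R, (crossing a x + crossing x a + crossing b x + crossing x b) := by
  have hself : ∀ x : Fin (p + q) × Fin (p + q), crossing x x = 0 := by simp [crossing]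
  simp only [Finset.sum_insert ha, Finset.sum_insert hb, Finset.sum_sub_distrib,
    Finset.sum_add_distrib, hself]
  ring

theorem ne_of_mem_otherArcs {c : Clan p q} {i j k l : Fin (p + q)}
    (hij : c.IsMatch i j) (hkl : c.IsMatch k l) {x : Fin (p + q) × Fin (p + q)}
    (hx : x ∈ c.otherArcs i k) :
    x.1 < x.2 ∧ (x.1 ≠ i ∧ x.1 ≠ j ∧ x.1 ≠ k ∧ x.1 ≠ l) ∧
      x.2 ≠ i ∧ x.2 ≠ j ∧ x.2 ≠ k ∧ x.2 ≠ l := by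
  obtain ⟨a, b⟩ := x
  simp only [otherArcs, mem_arcs, Finset.mem_filter] at hx
  obtain ⟨⟨hab, hmate⟩, hai, hak⟩ := hx
  have := hij.1
  have := hij.2
  have := hkl.1
  have := hkl.2
  have := hij.mate_right
  have := hkl.mate_right
  have := c.mate_invol a
  refine ⟨hab, ⟨hai, ?_, hak, ?_⟩, ?_, ?_, ?_, ?_⟩ <;> rintro rfl <;> grind

theorem otherArcs_eq_of_agreeOutside {c c' : Clan p q} {i j k l : Fin (p + q)}
    (hij : c.IsMatch i j) (hkl : c.IsMatch k l)
    (hik : c'.IsMatch i k) (hjl : c'.IsMatch j l)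
    (hagree : AgreeOutside c c' {i, j, k, l}) :
    c'.otherArcs i j = c.otherArcs i k := by
  ext x
  constructor <;> intro hx
  · have hne := ne_of_mem_otherArcs hik hjl hx
    have hmate := (hagree x.1 (by simp; tauto)).1
    simp only [otherArcs, mem_arcs, Finset.mem_filter, IsMatch] at hx ⊢
    rw [hmate]
    tauto
  · have hne := ne_of_mem_otherArcs hij hkl hx
    have hmate := (hagree x.1 (by simp; tauto)).1
    simp only [otherArcs, mem_arcs, Finset.mem_filter, IsMatch] at hx ⊢
    rw [← hmate]
    tauto

/-- An arc avoiding `i < j < k < l` crosses `(i, k)` and `(j, l)` as often as it crosses `(i, j)`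
and `(k, l)`, except for two further crossings if it joins the gap between `j` and `k` to a
position left of `i` or right of `l`. -/
theorem crossing_swap {i j k l : Fin (p + q)} (hij : i < j) (hjk : j < k) (hkl : k < l)
    {x : Fin (p + q) × Fin (p + q)} (hx : x.1 < x.2)
    (h₁ : x.1 ≠ i ∧ x.1 ≠ j ∧ x.1 ≠ k ∧ x.1 ≠ l)
    (h₂ : x.2 ≠ i ∧ x.2 ≠ j ∧ x.2 ≠ k ∧ x.2 ≠ l) :
    crossing (i, k) x + crossing x (i, k) + crossing (j, l) x + crossing x (j, l) =
      crossing (i, j) x + crossing x (i, j) + crossing (k, l) x + crossing x (k, l) +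
        2 * ((if x.1 < i ∧ j < x.2 ∧ x.2 < k then 1 else 0) +
          (if j < x.1 ∧ x.1 < k ∧ l < x.2 then 1 else 0)) := by
  obtain ⟨a, b⟩ := x
  simp only [crossing]
  simp only [ne_eq, Fin.ext_iff, Fin.lt_def] at *
  rcases lt_or_gt_of_ne h₁.1 with h | h <;> rcases lt_or_gt_of_ne h₁.2.1 with h' | h' <;>
    rcases lt_or_gt_of_ne h₁.2.2.1 with h'' | h'' <;> grind

end Clan

/-- the length change of the transposition (T.7), `1122 ↦ 1212`. -/
theorem t7_length_difference {p q : ℕ} (c c' : Clan p q) (i j k l : Fin (p + q))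
    (hij : c.IsMatch i j) (hjk : j < k) (hkl : c.IsMatch k l)
    (hik : c'.IsMatch i k) (hjl : c'.IsMatch j l)
    (hagree : Clan.AgreeOutside c c' {i, j, k, l}) :
    c'.len - c.len =
      2 * (((k : ℕ) : ℤ) - ((j : ℕ) : ℤ)) - 1 -
        2 * (((Finset.univ.filter fun ab : Fin (p + q) × Fin (p + q) =>
                  c.IsMatch ab.1 ab.2 ∧ ab.1 < i ∧ j < ab.2 ∧ ab.2 < k).card : ℤ) +
              ((Finset.univ.filter fun ab : Fin (p + q) × Fin (p + q) =>
                  c.IsMatch ab.1 ab.2 ∧ j < ab.1 ∧ ab.1 < k ∧ l < ab.2).card : ℤ)) := by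
  have hi := hij.1
  have hk := hkl.1
  have hR := Clan.otherArcs_eq_of_agreeOutside hij hkl hik hjl hagree
  have hne := fun x hx => Clan.ne_of_mem_otherArcs hij hkl (x := x) hx
  rw [c.card_filter_isMatch_and fun x => x.1 < i ∧ j < x.2 ∧ x.2 < k,
    c.card_filter_isMatch_and fun x => j < x.1 ∧ x.1 < k ∧ l < x.2,
    Clan.len_eq_sum_arcs, Clan.len_eq_sum_arcs, Clan.arcs_eq_insert hij hkl,
    Clan.arcs_eq_insert hik hjl, hR]
  generalize c.otherArcs i k = R at hne ⊢
  have hkl_notMem : (k, l) ∉ R := fun h => (hne _ h).2.1.2.2.1 rfl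
  have hjl_notMem : (j, l) ∉ R := fun h => (hne _ h).2.1.2.1 rfl
  have hij_notMem : (i, j) ∉ insert (k, l) R := by
    rw [Finset.mem_insert, not_or]
    exact ⟨by grind, fun h => (hne _ h).2.1.1 rfl⟩
  have hik_notMem : (i, k) ∉ insert (j, l) R := by
    rw [Finset.mem_insert, not_or]
    exact ⟨by grind, fun h => (hne _ h).2.1.1 rfl⟩
  have hswap := Finset.sum_congr (rfl : R = R) fun x hx =>
    Clan.crossing_swap hi hjk hk (hne x hx).1 (hne x hx).2.1 (hne x hx).2.2
  simp only [Finset.sum_add_distrib, ← Finset.mul_sum] at hswap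
  rw [Clan.sum_insert_insert hik_notMem hjl_notMem fun x => ((x.2 : ℕ) : ℤ) - ((x.1 : ℕ) : ℤ),
    Clan.sum_insert_insert hij_notMem hkl_notMem fun x => ((x.2 : ℕ) : ℤ) - ((x.1 : ℕ) : ℤ)]
  have h₁ : Clan.crossing (i, k) (j, l) = 1 := by simp [Clan.crossing, hi, hjk, hk]
  have h₂ : Clan.crossing (j, l) (i, k) = 0 := by simp [Clan.crossing, hi.not_gt]
  have h₃ : Clan.crossing (i, j) (k, l) = 0 := by simp [Clan.crossing, hjk.not_gt]
  have h₄ : Clan.crossing (k, l) (i, j) = 0 := by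
    simp [Clan.crossing, (hi.trans hjk).not_gt]
  simp only [Finset.sum_insert hij_notMem, Finset.sum_insert hkl_notMem, h₁, h₂, h₃, h₄,
    hi.not_gt, hk.not_gt, lt_irrefl, false_and, and_false, if_false,
    Finset.sum_add_distrib]
  linarith
end
end

section
/- Let α ≤ γ in Clans_{p,q}, and suppose θ ∈ Clans_{r,s} pattern contains γ via indices I = {i_1<…<i_{p+q}}. Let Φ(α) be the unique (r,s)-clan that pattern contains α via the same indices I and agrees with θ at all positions outside I. Then Φ(α) ≤ θ and ℓ(γ) − ℓ(α) ≤ ℓ(θ) − ℓ(Φ(α)). -/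
noncomputable section
open scoped Classical

namespace Clan

variable {p q r s : ℕ}

/-- The contribution of the ordered pair of positions `(x, y)` to the length of a clan with
matching involution `σ`. -/
def lenTerm {n : ℕ} (σ : Fin n → Fin n) (x y : Fin n) : ℤ :=
  (if x ≤ y ∧ y < σ x then 1 else 0) - (if y < x ∧ x < σ y ∧ σ y < σ x then 1 else 0)

theorem sum_isMatch {M : Type*} [AddCommMonoid M] (c : Clan p q)
    (F : Fin (p + q) → Fin (p + q) → M) :
    ∑ ij ∈ Finset.univ.filter (fun ij : Fin (p + q) × Fin (p + q) => c.IsMatch ij.1 ij.2),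
        F ij.1 ij.2
      = ∑ i, if i < c.mate i then F i (c.mate i) else 0 := by
  rw [Finset.sum_filter, Fintype.sum_prod_type]
  refine Finset.sum_congr rfl fun i _ => ?_
  rw [Finset.sum_eq_single (c.mate i)]
  · simp [IsMatch]
  · intro j _ hj
    exact if_neg fun h => hj h.2.symm
  · simp

theorem len_eq_sum (c : Clan p q) : c.len = ∑ x, ∑ y, lenTerm c.mate x y := by
  unfold len
  rw [c.sum_isMatch (fun i j => (((j : ℕ) : ℤ) - ((i : ℕ) : ℤ) -
      ((Finset.univ.filter (fun st : Fin (p + q) × Fin (p + q) =>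
          c.IsMatch st.1 st.2 ∧ st.1 < i ∧ i < st.2 ∧ st.2 < j)).card : ℤ)))]
  refine Finset.sum_congr rfl fun i _ => ?_
  have hcross : ((Finset.univ.filter (fun st : Fin (p + q) × Fin (p + q) =>
      c.IsMatch st.1 st.2 ∧ st.1 < i ∧ i < st.2 ∧ st.2 < c.mate i)).card : ℤ)
      = ∑ y, if y < i ∧ i < c.mate y ∧ c.mate y < c.mate i then (1 : ℤ) else 0 := by
    rw [← Finset.filter_filter, Finset.card_filter, Nat.cast_sum,
      c.sum_isMatch (fun s t => ((if s < i ∧ i < t ∧ t < c.mate i then 1 else 0 : ℕ) : ℤ))]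
    refine Finset.sum_congr rfl fun y _ => ?_
    by_cases h : y < i ∧ i < c.mate y ∧ c.mate y < c.mate i
    · simp [h, h.1.trans h.2.1]
    · simp [h]
  have hspan : (∑ y, if i ≤ y ∧ y < c.mate i then (1 : ℤ) else 0)
      = ((c.mate i - i : ℕ) : ℤ) := by
    rw [← Fin.card_Ico, Finset.sum_boole]
    congr 2
    ext y
    simp
  simp only [lenTerm, Finset.sum_sub_distrib]
  rw [hspan, ← hcross]
  split_ifs with h
  · rw [Nat.cast_sub (le_of_lt h)]
  · have h0 : (c.mate i - i : ℕ) = 0 := by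
      have : ¬ ((i : ℕ) < c.mate i) := h
      omega
    have h1 : (Finset.univ.filter (fun st : Fin (p + q) × Fin (p + q) =>
        c.IsMatch st.1 st.2 ∧ st.1 < i ∧ i < st.2 ∧ st.2 < c.mate i)) = ∅ :=
      Finset.filter_eq_empty_iff.2 fun st _ hst => h (hst.2.2.1.trans hst.2.2.2)
    rw [h0, h1]
    simp

/-- The positions outside the range of `ι`. -/
def outside {m n : ℕ} (ι : Fin m → Fin n) : Finset (Fin n) :=
  Finset.univ.filter fun x => ∀ k, ι k ≠ x

theorem mem_outside {m n : ℕ} {ι : Fin m → Fin n} {x : Fin n} :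
    x ∈ outside ι ↔ ∀ k, ι k ≠ x := by
  simp [outside]

theorem sum_eq_sum_add_sum_outside {m n : ℕ} {ι : Fin m → Fin n} (hι : Function.Injective ι)
    {M : Type*} [AddCommMonoid M] (f : Fin n → M) :
    ∑ x, f x = ∑ k, f (ι k) + ∑ x ∈ outside ι, f x := by
  rw [← Finset.sum_image (f := f) (g := ι) (s := Finset.univ) (hι.injOn),
    ← Finset.sum_filter_add_sum_filter_not Finset.univ (fun x => ∃ k, ι k = x) f]
  congr 2
  · ext x
    simp
  · ext x
    simp [outside]

namespace Pattern

variable {φ φ' : Clan r s} {c c' : Clan p q} {ι : Fin (p + q) → Fin (r + s)}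

theorem mate_apply (h : Pattern φ c ι) (k : Fin (p + q)) : φ.mate (ι k) = ι (c.mate k) := by
  rcases lt_trichotomy k (c.mate k) with hk | hk | hk
  · exact (h.2.2 k _ ⟨hk, rfl⟩).2
  · rw [(h.2.1 k hk.symm).1, ← hk]
  · have := (h.2.2 (c.mate k) k ⟨hk, c.mate_invol k⟩).2
    rw [← this, φ.mate_invol]

theorem sign_apply (h : Pattern φ c ι) (k : Fin (p + q)) : φ.sign (ι k) = c.sign k := by
  by_cases hk : c.mate k = k
  · exact (h.2.1 k hk).2
  · rw [c.sign_matched k hk, φ.sign_matched]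
    rw [h.mate_apply]
    exact fun he => hk (h.1.injective he)

theorem of_apply (hι : StrictMono ι) (hm : ∀ k, φ.mate (ι k) = ι (c.mate k))
    (hs : ∀ k, φ.sign (ι k) = c.sign k) : Pattern φ c ι :=
  ⟨hι, fun j hj => ⟨by rw [hm, hj], hs j⟩,
    fun k l h => ⟨hι h.1, by rw [hm, h.2]⟩⟩

theorem isMatch (h : Pattern φ c ι) {i j : Fin (p + q)} (hij : c.IsMatch i j) :
    φ.IsMatch (ι i) (ι j) := h.2.2 i j hij

theorem isPlus (h : Pattern φ c ι) {i : Fin (p + q)} (hi : c.IsPlus i) : φ.IsPlus (ι i) :=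
  ⟨(h.2.1 i hi.1).1, (h.2.1 i hi.1).2.trans hi.2⟩

theorem isMinus (h : Pattern φ c ι) {i : Fin (p + q)} (hi : c.IsMinus i) : φ.IsMinus (ι i) :=
  ⟨(h.2.1 i hi.1).1, (h.2.1 i hi.1).2.trans hi.2⟩

theorem mate_mem_outside (h : Pattern φ c ι) {x : Fin (r + s)} (hx : x ∈ outside ι) :
    φ.mate x ∈ outside ι := by
  rw [mem_outside] at hx ⊢
  intro k hk
  refine hx (c.mate k) ?_
  rw [← h.mate_apply, hk, φ.mate_invol]

/-- A clan containing `c` can be modified to contain any other clan at the same positions. -/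
theorem exists_replace (h : Pattern φ c ι) (c' : Clan p q) :
    ∃ φ' : Clan r s, Pattern φ' c' ι ∧ AgreesWithOutside φ' φ ι := by
  have hinj := h.1.injective
  set μ : Fin (r + s) → Fin (r + s) := Function.extend ι (ι ∘ c'.mate) φ.mate
  set ε : Fin (r + s) → Bool := Function.extend ι c'.sign φ.sign
  have μ_in : ∀ k, μ (ι k) = ι (c'.mate k) := fun k => hinj.extend_apply _ _ k
  have ε_in : ∀ k, ε (ι k) = c'.sign k := fun k => hinj.extend_apply _ _ k
  have μ_out : ∀ x, (∀ k, ι k ≠ x) → μ x = φ.mate x := fun x hx =>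
    Function.extend_apply' _ _ x fun ⟨k, hk⟩ => hx k hk
  have ε_out : ∀ x, (∀ k, ι k ≠ x) → ε x = φ.sign x := fun x hx =>
    Function.extend_apply' _ _ x fun ⟨k, hk⟩ => hx k hk
  have hcount : ∀ b : Bool, ∀ (ψ : Fin (r + s) → Fin (r + s)) (η : Fin (r + s) → Bool)
      (d : Clan p q), (∀ k, ψ (ι k) = ι (d.mate k)) → (∀ k, η (ι k) = d.sign k) →
      (∀ x, (∀ k, ι k ≠ x) → ψ x = φ.mate x) → (∀ x, (∀ k, ι k ≠ x) → η x = φ.sign x) →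
      (Finset.univ.filter fun x => ψ x = x ∧ η x = b).card
        = (Finset.univ.filter fun k => d.mate k = k ∧ d.sign k = b).card
          + ∑ x ∈ outside ι, if φ.mate x = x ∧ φ.sign x = b then 1 else 0 := by
    intro b ψ η d h1 h2 h3 h4
    rw [Finset.card_filter, Finset.card_filter, sum_eq_sum_add_sum_outside hinj]
    congr 1
    · refine Finset.sum_congr rfl fun k _ => ?_
      simp only [h1, h2, hinj.eq_iff]
    · refine Finset.sum_congr rfl fun x hx => ?_
      rw [h3 x (mem_outside.1 hx), h4 x (mem_outside.1 hx)]
  refine ⟨⟨μ, ?_, ε, ?_, ?_⟩, of_apply h.1 μ_in ε_in, fun x hx => ⟨μ_out x hx, ε_out x hx⟩⟩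
  · intro x
    by_cases hx : ∃ k, ι k = x
    · obtain ⟨k, rfl⟩ := hx
      rw [μ_in, μ_in, c'.mate_invol]
    · push Not at hx
      rw [μ_out x hx, μ_out _ (mem_outside.1 (h.mate_mem_outside (mem_outside.2 hx))),
        φ.mate_invol]
  · intro x hne
    by_cases hx : ∃ k, ι k = x
    · obtain ⟨k, rfl⟩ := hx
      rw [ε_in]
      refine c'.sign_matched k fun hk => hne ?_
      rw [μ_in, hk]
    · push Not at hx
      rw [μ_out x hx] at hne
      rw [ε_out x hx, φ.sign_matched x hne]
  · have e1 := hcount true μ ε c' μ_in ε_in μ_out ε_out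
    have e2 := hcount false μ ε c' μ_in ε_in μ_out ε_out
    have e3 := hcount true φ.mate φ.sign c h.mate_apply h.sign_apply
      (fun _ _ => rfl) (fun _ _ => rfl)
    have e4 := hcount false φ.mate φ.sign c h.mate_apply h.sign_apply
      (fun _ _ => rfl) (fun _ _ => rfl)
    have := c.plus_minus
    have := c'.plus_minus
    have := φ.plus_minus
    omega

theorem eq_of_agreesWithOutside (h : Pattern φ c ι) (h' : Pattern φ' c ι)
    (ho : AgreesWithOutside φ φ' ι) : φ = φ' := by
  have hm : φ.mate = φ'.mate := by
    funext x
    by_cases hx : ∃ k, ι k = x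
    · obtain ⟨k, rfl⟩ := hx
      rw [h.mate_apply, h'.mate_apply]
    · push Not at hx
      exact (ho x hx).1
  have hs : φ.sign = φ'.sign := by
    funext x
    by_cases hx : ∃ k, ι k = x
    · obtain ⟨k, rfl⟩ := hx
      rw [h.sign_apply, h'.sign_apply]
    · push Not at hx
      exact (ho x hx).2
  cases φ
  cases φ'
  simp only at hm hs
  subst hm hs
  rfl

theorem agreeOutside_image (h : Pattern φ c ι) (h' : Pattern φ' c' ι)
    (ho : AgreesWithOutside φ φ' ι) {S : Set (Fin (p + q))} (hS : AgreeOutside c c' S) :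
    AgreeOutside φ φ' (ι '' S) := by
  intro x hx
  by_cases hk : ∃ k, ι k = x
  · obtain ⟨k, rfl⟩ := hk
    have hkS : k ∉ S := fun hk => hx ⟨k, hk, rfl⟩
    rw [h.mate_apply, h'.mate_apply, h.sign_apply, h'.sign_apply, (hS k hkS).1, (hS k hkS).2]
    exact ⟨rfl, rfl⟩
  · push Not at hk
    exact ho x hk

/-- Transpositions lift along pattern containment. -/
theorem transposition (h : Pattern φ c ι) (h' : Pattern φ' c' ι)
    (ho : AgreesWithOutside φ φ' ι) (ht : Transposition c c') : Transposition φ φ' := by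
  have hS : ∀ S, AgreeOutside c c' S → AgreeOutside φ φ' (ι '' S) := fun S =>
    h.agreeOutside_image h' ho
  have hι := h.1
  rcases ht with ⟨a, b, h1, h2, h3, h4, h5⟩ | ⟨a, b, h1, h2, h3, h4, h5⟩ |
    ⟨a, b, d, h1, h2, h3, h4, h5, h6⟩ | ⟨a, b, d, h1, h2, h3, h4, h5, h6⟩ |
    ⟨a, b, d, h1, h2, h3, h4, h5, h6⟩ | ⟨a, b, d, h1, h2, h3, h4, h5, h6⟩ |
    ⟨i, j, k, l, h1, h2, h3, h4, h5, h6⟩ | ⟨i, j, k, l, h1, h2, h3, h4, h5, h6, h7⟩ |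
    ⟨i, j, k, l, h1, h2, h3, h4, h5, h6, h7⟩ | ⟨i, j, k, l, h1, h2, h3, h4, h5, h6, h7, h8⟩
  · exact Or.inl ⟨_, _, hι h1, h.isPlus h2, h.isMinus h3, h'.isMatch h4,
      by simpa [Set.image_insert_eq] using hS _ h5⟩
  · exact Or.inr <| Or.inl ⟨_, _, hι h1, h.isMinus h2, h.isPlus h3, h'.isMatch h4,
      by simpa [Set.image_insert_eq] using hS _ h5⟩
  · exact Or.inr <| Or.inr <| Or.inl ⟨_, _, _, h.isMatch h1, hι h2, h.isPlus h3,
      h'.isMatch h4, h'.isPlus h5, by simpa [Set.image_insert_eq] using hS _ h6⟩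
  · exact Or.inr <| Or.inr <| Or.inr <| Or.inl ⟨_, _, _, h.isMatch h1, hι h2, h.isMinus h3,
      h'.isMatch h4, h'.isMinus h5, by simpa [Set.image_insert_eq] using hS _ h6⟩
  · exact Or.inr <| Or.inr <| Or.inr <| Or.inr <| Or.inl ⟨_, _, _, h.isPlus h1, hι h2,
      h.isMatch h3, h'.isMatch h4, h'.isPlus h5,
      by simpa [Set.image_insert_eq] using hS _ h6⟩
  · exact Or.inr <| Or.inr <| Or.inr <| Or.inr <| Or.inr <| Or.inl ⟨_, _, _, h.isMinus h1,
      hι h2, h.isMatch h3, h'.isMatch h4, h'.isMinus h5,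
      by simpa [Set.image_insert_eq] using hS _ h6⟩
  · exact Or.inr <| Or.inr <| Or.inr <| Or.inr <| Or.inr <| Or.inr <| Or.inl
      ⟨_, _, _, _, h.isMatch h1, hι h2, h.isMatch h3, h'.isMatch h4, h'.isMatch h5,
      by simpa [Set.image_insert_eq] using hS _ h6⟩
  · exact Or.inr <| Or.inr <| Or.inr <| Or.inr <| Or.inr <| Or.inr <| Or.inr <| Or.inl
      ⟨_, _, _, _, h.isMatch h1, hι h2, h.isMatch h3, h'.isMatch h4, h'.isPlus h5,
      h'.isMinus h6, by simpa [Set.image_insert_eq] using hS _ h7⟩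
  · exact Or.inr <| Or.inr <| Or.inr <| Or.inr <| Or.inr <| Or.inr <| Or.inr <| Or.inr <|
      Or.inl ⟨_, _, _, _, h.isMatch h1, hι h2, h.isMatch h3, h'.isMatch h4, h'.isMinus h5,
      h'.isPlus h6, by simpa [Set.image_insert_eq] using hS _ h7⟩
  · exact Or.inr <| Or.inr <| Or.inr <| Or.inr <| Or.inr <| Or.inr <| Or.inr <| Or.inr <|
      Or.inr ⟨_, _, _, _, hι h1, hι h2, hι h3, h.isMatch h4, h.isMatch h5, h'.isMatch h6,
      h'.isMatch h7, by simpa [Set.image_insert_eq] using hS _ h8⟩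

end Pattern

/-- The number of matchings of `c` which, placed at the positions `ι`, enclose both `u`
and `v`. -/
def numEnclosing {n : ℕ} (c : Clan p q) (ι : Fin (p + q) → Fin n) (u v : Fin n) : ℤ :=
  ∑ k, if (ι k < u ∧ ι k < v) ∧ u < ι (c.mate k) ∧ v < ι (c.mate k) then 1 else 0

theorem Pattern.len_eq {φ : Clan r s} {c : Clan p q} {ι : Fin (p + q) → Fin (r + s)}
    (h : Pattern φ c ι) :
    φ.len = c.len
      + ((∑ x ∈ outside ι, ∑ y ∈ outside ι, lenTerm φ.mate x y)
        + ∑ x ∈ outside ι, ∑ k, if x ≤ ι k ∧ ι k < φ.mate x then 1 else 0)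
      + ∑ x ∈ outside ι, c.numEnclosing ι x (φ.mate x) := by
  have hinj := h.1.injective
  have hin : ∀ k l, lenTerm φ.mate (ι k) (ι l) = lenTerm c.mate k l := by
    intro k l
    simp only [lenTerm, h.mate_apply, h.1.lt_iff_lt, h.1.le_iff_le]
  have hswap : ∀ k, (∑ x ∈ outside ι,
        if x < ι k ∧ ι k < φ.mate x ∧ φ.mate x < ι (c.mate k) then (1 : ℤ) else 0)
      = ∑ x ∈ outside ι,
        if φ.mate x < ι k ∧ ι k < x ∧ x < ι (c.mate k) then (1 : ℤ) else 0 := by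
    intro k
    refine Finset.sum_nbij' φ.mate φ.mate (fun x hx => h.mate_mem_outside hx)
      (fun x hx => h.mate_mem_outside hx) (fun x _ => φ.mate_invol x)
      (fun x _ => φ.mate_invol x) (fun x _ => ?_)
    rw [φ.mate_invol]
  have hmix : (∑ k, ∑ x ∈ outside ι, lenTerm φ.mate (ι k) x)
      + (∑ x ∈ outside ι, ∑ k, lenTerm φ.mate x (ι k))
      = (∑ x ∈ outside ι, ∑ k, if x ≤ ι k ∧ ι k < φ.mate x then 1 else 0)
        + ∑ x ∈ outside ι, c.numEnclosing ι x (φ.mate x) := by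
    simp only [lenTerm, Finset.sum_sub_distrib, numEnclosing, h.mate_apply]
    rw [Finset.sum_congr rfl fun k _ => hswap k]
    rw [Finset.sum_comm (s := Finset.univ) (t := outside ι),
      Finset.sum_comm (s := Finset.univ) (t := outside ι)]
    simp only [← Finset.sum_sub_distrib, ← Finset.sum_add_distrib]
    refine Finset.sum_congr rfl fun x hx => Finset.sum_congr rfl fun k _ => ?_
    have n1 := mem_outside.1 hx k
    have n2 := mem_outside.1 hx (c.mate k)
    have n3 := mem_outside.1 (h.mate_mem_outside hx) k
    have n4 := mem_outside.1 (h.mate_mem_outside hx) (c.mate k)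
    revert n1 n2 n3 n4
    generalize ι k = a
    generalize ι (c.mate k) = b
    generalize φ.mate x = y
    intro n1 n2 n3 n4
    split_ifs <;> omega
  rw [len_eq_sum, len_eq_sum, sum_eq_sum_add_sum_outside hinj]
  simp only [sum_eq_sum_add_sum_outside hinj (fun y => lenTerm φ.mate _ y),
    Finset.sum_add_distrib, hin]
  linarith

theorem sum_le_sum_of_agreeOutside {c c' : Clan p q} {S : Finset (Fin (p + q))}
    (hS : AgreeOutside c c' S) (f : Fin (p + q) → Fin (p + q) → ℤ)
    (hf : ∑ k ∈ S, f k (c.mate k) ≤ ∑ k ∈ S, f k (c'.mate k)) :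
    ∑ k, f k (c.mate k) ≤ ∑ k, f k (c'.mate k) := by
  rw [← Finset.sum_add_sum_compl S, ← Finset.sum_add_sum_compl S (fun k => f k (c'.mate k))]
  refine add_le_add hf (le_of_eq (Finset.sum_congr rfl fun k hk => ?_))
  rw [(hS k (by simpa using hk)).1]

/-- Transpositions do not decrease the number of enclosing matchings. -/
theorem Transposition.numEnclosing_le {n : ℕ} {c c' : Clan p q} (ht : Transposition c c')
    {ι : Fin (p + q) → Fin n} (hι : StrictMono ι) (u v : Fin n) :
    c.numEnclosing ι u v ≤ c'.numEnclosing ι u v := by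
  set f : Fin (p + q) → Fin (p + q) → ℤ := fun k l =>
    if (ι k < u ∧ ι k < v) ∧ u < ι l ∧ v < ι l then 1 else 0 with hf
  change ∑ k, f k (c.mate k) ≤ ∑ k, f k (c'.mate k)
  have f_nonneg : ∀ k l, 0 ≤ f k l := fun k l => by
    simp only [hf]; split_ifs <;> simp
  have f_zero : ∀ k l, l ≤ k → f k l = 0 := fun k l hkl => by
    have := hι.monotone hkl
    simp only [hf]; split_ifs <;> omega
  have f_mono : ∀ k k' l l', k' ≤ k → l ≤ l' → f k l ≤ f k' l' := fun k k' l l' hk hl => by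
    have := hι.monotone hk
    have := hι.monotone hl
    simp only [hf]; split_ifs <;> omega
  have f_exch : ∀ i j k l, i ≤ j → k ≤ l → f i k + f j l ≤ f i l + f j k :=
    fun i j k l hk hl => by
      have := hι.monotone hk
      have := hι.monotone hl
      simp only [hf]; split_ifs <;> omega
  have f_disj : ∀ i j k l, i < j → j < k → k < l → f i j + f k l ≤ f i l :=
    fun i j k l h1 h2 h3 => by
      have := hι h1
      have := hι h2
      have := hι h3
      simp only [hf]; split_ifs <;> omega
  have sum2 : ∀ (a b : Fin (p + q)), a < b → ∀ g : Fin (p + q) → ℤ,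
      ∑ k ∈ ({a, b} : Finset (Fin (p + q))), g k = g a + g b := fun a b hab g =>
    Finset.sum_pair hab.ne
  have sum3 : ∀ (a b d : Fin (p + q)), a < b → b < d → ∀ g : Fin (p + q) → ℤ,
      ∑ k ∈ ({a, b, d} : Finset (Fin (p + q))), g k = g a + (g b + g d) :=
    fun a b d hab hbd g => by
      rw [Finset.sum_insert (by simp [hab.ne, (hab.trans hbd).ne]), sum2 b d hbd]
  have sum4 : ∀ (a b d e : Fin (p + q)), a < b → b < d → d < e → ∀ g : Fin (p + q) → ℤ,
      ∑ k ∈ ({a, b, d, e} : Finset (Fin (p + q))), g k = g a + (g b + (g d + g e)) :=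
    fun a b d e hab hbd hde g => by
      rw [Finset.sum_insert (by simp [hab.ne, (hab.trans hbd).ne, (hab.trans (hbd.trans hde)).ne]),
        sum3 b d e hbd hde]
  have mate_right : ∀ (e : Clan p q) {i j}, e.IsMatch i j → e.mate j = i := fun e i j h => by
    rw [← h.2, e.mate_invol]
  have two : ∀ a b, a < b → c.mate a = a → c.mate b = b → AgreeOutside c c' {a, b} →
      ∑ k, f k (c.mate k) ≤ ∑ k, f k (c'.mate k) := by
    intro a b hab ha hb hS
    refine sum_le_sum_of_agreeOutside (S := {a, b}) (by simpa using hS) f ?_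
    rw [sum2 a b hab, sum2 a b hab, ha, hb, f_zero a a le_rfl, f_zero b b le_rfl]
    have := f_nonneg a (c'.mate a)
    have := f_nonneg b (c'.mate b)
    omega
  have three_left : ∀ a b d, c.IsMatch a b → b < d → c.mate d = d → c'.IsMatch a d →
      AgreeOutside c c' {a, b, d} → ∑ k, f k (c.mate k) ≤ ∑ k, f k (c'.mate k) := by
    intro a b d hab hbd hd had hS
    refine sum_le_sum_of_agreeOutside (S := {a, b, d}) (by simpa using hS) f ?_
    rw [sum3 a b d hab.1 hbd, sum3 a b d hab.1 hbd, hab.2, mate_right c hab, hd, had.2,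
      f_zero b a hab.1.le, f_zero d d le_rfl]
    have := f_nonneg b (c'.mate b)
    have := f_nonneg d (c'.mate d)
    have := f_mono a a b d le_rfl hbd.le
    omega
  have three_right : ∀ a b d, c.mate a = a → a < b → c.IsMatch b d → c'.IsMatch a d →
      AgreeOutside c c' {a, b, d} → ∑ k, f k (c.mate k) ≤ ∑ k, f k (c'.mate k) := by
    intro a b d ha hab hbd had hS
    refine sum_le_sum_of_agreeOutside (S := {a, b, d}) (by simpa using hS) f ?_
    rw [sum3 a b d hab hbd.1, sum3 a b d hab hbd.1, hbd.2, mate_right c hbd, ha, had.2,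
      f_zero d b hbd.1.le, f_zero a a le_rfl]
    have := f_nonneg b (c'.mate b)
    have := f_nonneg d (c'.mate d)
    have := f_mono b a d d hab.le le_rfl
    omega
  have four : ∀ i j k l, c.IsMatch i j → j < k → c.IsMatch k l →
      f i j + f k l ≤ f i (c'.mate i) + f j (c'.mate j) →
      AgreeOutside c c' {i, j, k, l} → ∑ k, f k (c.mate k) ≤ ∑ k, f k (c'.mate k) := by
    intro i j k l hij hjk hkl hle hS
    refine sum_le_sum_of_agreeOutside (S := {i, j, k, l}) (by simpa using hS) f ?_
    rw [sum4 i j k l hij.1 hjk hkl.1, sum4 i j k l hij.1 hjk hkl.1, hij.2, mate_right c hij,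
      hkl.2, mate_right c hkl, f_zero j i hij.1.le, f_zero l k hkl.1.le]
    have := f_nonneg k (c'.mate k)
    have := f_nonneg l (c'.mate l)
    omega
  rcases ht with ⟨a, b, h1, h2, h3, h4, h5⟩ | ⟨a, b, h1, h2, h3, h4, h5⟩ |
    ⟨a, b, d, h1, h2, h3, h4, h5, h6⟩ | ⟨a, b, d, h1, h2, h3, h4, h5, h6⟩ |
    ⟨a, b, d, h1, h2, h3, h4, h5, h6⟩ | ⟨a, b, d, h1, h2, h3, h4, h5, h6⟩ |
    ⟨i, j, k, l, h1, h2, h3, h4, h5, h6⟩ | ⟨i, j, k, l, h1, h2, h3, h4, h5, h6, h7⟩ |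
    ⟨i, j, k, l, h1, h2, h3, h4, h5, h6, h7⟩ | ⟨i, j, k, l, h1, h2, h3, h4, h5, h6, h7, h8⟩
  · exact two a b h1 h2.1 h3.1 h5
  · exact two a b h1 h2.1 h3.1 h5
  · exact three_left a b d h1 h2 h3.1 h4 h6
  · exact three_left a b d h1 h2 h3.1 h4 h6
  · exact three_right a b d h1.1 h2 h3 h4 h6
  · exact three_right a b d h1.1 h2 h3 h4 h6
  · refine four i j k l h1 h2 h3 ?_ h6
    rw [h4.2, h5.2]
    exact add_le_add (f_mono _ _ _ _ le_rfl h2.le) (f_mono _ _ _ _ h2.le le_rfl)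
  · refine four i j k l h1 h2 h3 ?_ h7
    rw [h4.2]
    have := f_nonneg j (c'.mate j)
    have := f_disj i j k l h1.1 h2 h3.1
    omega
  · refine four i j k l h1 h2 h3 ?_ h7
    rw [h4.2]
    have := f_nonneg j (c'.mate j)
    have := f_disj i j k l h1.1 h2 h3.1
    omega
  · refine sum_le_sum_of_agreeOutside (S := {i, j, k, l}) (by simpa using h8) f ?_
    rw [sum4 i j k l h1 h2 h3, sum4 i j k l h1 h2 h3, h4.2, h5.2, mate_right c h4,
      mate_right c h5, h6.2, h7.2, f_zero k i (h1.trans h2).le, f_zero l j (h2.trans h3).le]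
    have := f_nonneg k (c'.mate k)
    have := f_nonneg l (c'.mate l)
    have := f_exch i j k l h1.le h3.le
    omega

/-- Lifting a transposition along pattern containment can only enlarge its length increment. -/
theorem Transposition.len_sub_len_le {φ φ' : Clan r s} {c c' : Clan p q}
    {ι : Fin (p + q) → Fin (r + s)} (ht : Transposition c c') (h : Pattern φ c ι)
    (h' : Pattern φ' c' ι) (ho : AgreesWithOutside φ φ' ι) :
    c'.len - c.len ≤ φ'.len - φ.len := by
  have hm : ∀ x ∈ outside ι, φ.mate x = φ'.mate x := fun x hx => (ho x (mem_outside.1 hx)).1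
  rw [h.len_eq, h'.len_eq]
  have e1 : (∑ x ∈ outside ι, ∑ y ∈ outside ι, lenTerm φ.mate x y)
      = ∑ x ∈ outside ι, ∑ y ∈ outside ι, lenTerm φ'.mate x y :=
    Finset.sum_congr rfl fun x hx => Finset.sum_congr rfl fun y hy => by
      simp only [lenTerm, hm x hx, hm y hy]
  have e2 : (∑ x ∈ outside ι, ∑ k, if x ≤ ι k ∧ ι k < φ.mate x then (1 : ℤ) else 0)
      = ∑ x ∈ outside ι, ∑ k, if x ≤ ι k ∧ ι k < φ'.mate x then (1 : ℤ) else 0 :=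
    Finset.sum_congr rfl fun x hx => by rw [hm x hx]
  have e3 : (∑ x ∈ outside ι, c.numEnclosing ι x (φ.mate x))
      ≤ ∑ x ∈ outside ι, c'.numEnclosing ι x (φ'.mate x) :=
    Finset.sum_le_sum fun x hx => by
      rw [hm x hx]
      exact ht.numEnclosing_le h.1 _ _
  linarith

end Clan

/-- if `α ≤ γ`, `θ` pattern contains `γ` via `ι`, and `Φ(α)` is the clan
pattern containing `α` via `ι` and agreeing with `θ` outside the index set, then
`Φ(α) ≤ θ` and `ℓ(γ) - ℓ(α) ≤ ℓ(θ) - ℓ(Φ(α))`. -/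
theorem merely_embeds_length_ineq {p q r s : ℕ} (α γ : Clan p q) (θ φα : Clan r s)
    (ι : Fin (p + q) → Fin (r + s))
    (hαγ : Clan.ble α γ)
    (hθγ : Clan.Pattern θ γ ι)
    (hφα : Clan.Pattern φα α ι)
    (hout : Clan.AgreesWithOutside φα θ ι) :
    Clan.ble φα θ ∧ γ.len - α.len ≤ θ.len - φα.len := by
  have key : ∀ c, Clan.ble α c → ∃ φ : Clan r s, Clan.Pattern φ c ι ∧
      Clan.AgreesWithOutside φ φα ι ∧ Clan.ble φα φ ∧ c.len - α.len ≤ φ.len - φα.len := by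
    intro c hc
    induction hc with
    | refl => exact ⟨φα, hφα, fun _ _ => ⟨rfl, rfl⟩, .refl, by simp⟩
    | @tail c c' _ ht ih =>
      obtain ⟨φ, hφ, ho, hle, hlen⟩ := ih
      obtain ⟨φ', hφ', ho'⟩ := hφ.exists_replace c'
      have hs : Clan.AgreesWithOutside φ φ' ι := fun x hx =>
        ⟨(ho' x hx).1.symm, (ho' x hx).2.symm⟩
      refine ⟨φ', hφ', fun x hx => ⟨(ho' x hx).1.trans (ho x hx).1,
        (ho' x hx).2.trans (ho x hx).2⟩, hle.tail (hφ.transposition hφ' hs ht), ?_⟩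
      have := ht.len_sub_len_le hφ hφ' hs
      linarith
  obtain ⟨φ, hφ, ho, hle, hlen⟩ := key γ hαγ
  obtain rfl : φ = θ := hφ.eq_of_agreesWithOutside hθγ fun x hx =>
    ⟨(ho x hx).1.trans (hout x hx).1, (ho x hx).2.trans (hout x hx).2⟩
  exact ⟨hle, hlen⟩
end
end

section
/- Let α ≤ γ in Clans_{p,q}, and suppose θ ∈ Clans_{r,s} pattern contains γ via indices I = {i_1<…<i_{p+q}}. Let Φ(α) be the unique (r,s)-clan that pattern contains α via the same indices I and agrees with θ at all positions outside I, and assume ℓ(θ) − ℓ(Φ(α)) = ℓ(γ) − ℓ(α) (so [α,γ] interval pattern embeds into [Φ(α),θ]). If α ⋖ α' ≤ γ, then Φ(α) ⋖ Φ(α') ≤ θ, where Φ(α') is the unique clan pattern containing α' via I and agreeing with θ outside I. -/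
noncomputable section
open scoped Classical

namespace Clan

variable {p q r s : ℕ}

theorem eq_of_mate_sign {c d : Clan p q} (hm : c.mate = d.mate) (hs : c.sign = d.sign) :
    c = d := by
  cases c; cases d; cases hm; cases hs; rfl

/-- A sum over `β` splits along an injection `f : α → β`. -/
theorem sum_eq_sum_comp_add_sum_compl {α β M : Type*} [Fintype α] [Fintype β]
    [AddCommMonoid M] {f : α → β} [DecidablePred fun x => ∀ k, f k ≠ x]
    (hf : Function.Injective f) (F : β → M) :
    ∑ x, F x = ∑ k, F (f k) + ∑ x ∈ Finset.univ.filter (fun x => ∀ k, f k ≠ x), F x := by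
  rw [← Finset.sum_filter_add_sum_filter_not Finset.univ (fun x => ∃ k, f k = x) F]
  congr 1
  · rw [← Finset.sum_image (f := F) (s := Finset.univ) (g := f) (fun a _ b _ h => hf h)]
    congr 1
    ext x
    simp
  · congr 1
    ext x
    simp

theorem card_filter_eq_add {α β : Type*} [Fintype α] [Fintype β] {f : α → β}
    [DecidablePred fun x => ∀ k, f k ≠ x]
    (hf : Function.Injective f) (P : β → Prop) [DecidablePred P] :
    (Finset.univ.filter P).card = (Finset.univ.filter fun k => P (f k)).card +
      ((Finset.univ.filter (fun x => ∀ k, f k ≠ x)).filter P).card := by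
  simp only [Finset.card_filter _ Finset.univ]
  rw [sum_eq_sum_comp_add_sum_compl hf, Finset.card_filter]

/-- The clan `φ` restricts to `β` along `ι`. -/
def Restricts (φ : Clan r s) (β : Clan p q) (ι : Fin (p + q) → Fin (r + s)) : Prop :=
  ∀ k, φ.mate (ι k) = ι (β.mate k) ∧ φ.sign (ι k) = β.sign k

theorem Pattern.restricts {φ : Clan r s} {β : Clan p q} {ι : Fin (p + q) → Fin (r + s)}
    (h : Pattern φ β ι) : Restricts φ β ι := by
  obtain ⟨hι, hs, hm⟩ := h
  have hmate : ∀ k, φ.mate (ι k) = ι (β.mate k) := by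
    intro k
    rcases lt_trichotomy k (β.mate k) with hk | hk | hk
    · exact (hm k _ ⟨hk, rfl⟩).2
    · rw [← hk]; exact (hs k hk.symm).1
    · have h' := (hm (β.mate k) k ⟨hk, β.mate_invol k⟩).2
      rw [← h', φ.mate_invol]
  refine fun k => ⟨hmate k, ?_⟩
  by_cases hk : β.mate k = k
  · exact (hs k hk).2
  · rw [β.sign_matched k hk]
    exact φ.sign_matched _ fun h => hk (hι.injective ((hmate k).symm.trans h))

theorem Restricts.mate_notMem_range {θ : Clan r s} {γ : Clan p q}
    {ι : Fin (p + q) → Fin (r + s)} (h : Restricts θ γ ι) {m : Fin (r + s)}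
    (hm : ∀ k, ι k ≠ m) (k : Fin (p + q)) : ι k ≠ θ.mate m := by
  intro hk
  apply hm (γ.mate k)
  rw [← (h k).1, hk, θ.mate_invol]

/-- The clan obtained from `θ` by replacing its restriction `γ` along `ι` with `β`. -/
def substitute (θ : Clan r s) (γ : Clan p q) (ι : Fin (p + q) → Fin (r + s))
    (hι : Function.Injective ι) (h : Restricts θ γ ι) (β : Clan p q) : Clan r s where
  mate := Function.extend ι (ι ∘ β.mate) θ.mate
  mate_invol m := by
    by_cases hm : ∃ k, ι k = m
    · obtain ⟨k, rfl⟩ := hm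
      simp [hι.extend_apply, β.mate_invol]
    · rw [Function.extend_apply' _ _ m hm, Function.extend_apply', θ.mate_invol]
      push Not at hm ⊢
      exact h.mate_notMem_range hm
  sign := Function.extend ι β.sign θ.sign
  sign_matched m := by
    by_cases hm : ∃ k, ι k = m
    · obtain ⟨k, rfl⟩ := hm
      simpa [hι.extend_apply, hι.eq_iff] using β.sign_matched k
    · simpa [Function.extend_apply' _ _ m hm] using θ.sign_matched m
  plus_minus := by
    have key : ∀ b : Bool,
        (Finset.univ.filter fun m => Function.extend ι (ι ∘ β.mate) θ.mate m = m ∧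
          Function.extend ι β.sign θ.sign m = b).card +
        (Finset.univ.filter fun k => γ.mate k = k ∧ γ.sign k = b).card =
        (Finset.univ.filter fun m => θ.mate m = m ∧ θ.sign m = b).card +
        (Finset.univ.filter fun k => β.mate k = k ∧ β.sign k = b).card := by
      intro b
      rw [card_filter_eq_add hι, card_filter_eq_add hι (fun m => θ.mate m = m ∧ θ.sign m = b)]
      have h₁ : (Finset.univ.filter fun k => Function.extend ι (ι ∘ β.mate) θ.mate (ι k) = ι k ∧
          Function.extend ι β.sign θ.sign (ι k) = b) =
          Finset.univ.filter fun k => β.mate k = k ∧ β.sign k = b := by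
        simp [hι.extend_apply, hι.eq_iff]
      have h₂ : (Finset.univ.filter fun k => θ.mate (ι k) = ι k ∧ θ.sign (ι k) = b) =
          Finset.univ.filter fun k => γ.mate k = k ∧ γ.sign k = b := by
        simp [(h _).1, (h _).2, hι.eq_iff]
      have h₃ : ((Finset.univ.filter (fun x => ∀ k, ι k ≠ x)).filter fun m =>
          Function.extend ι (ι ∘ β.mate) θ.mate m = m ∧
            Function.extend ι β.sign θ.sign m = b) =
          (Finset.univ.filter (fun x => ∀ k, ι k ≠ x)).filter fun m =>
            θ.mate m = m ∧ θ.sign m = b := by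
        refine Finset.filter_congr fun m hm => ?_
        have hm' : ¬ ∃ k, ι k = m := by simpa using hm
        rw [Function.extend_apply' _ _ m hm', Function.extend_apply' _ _ m hm']
      rw [h₁, h₂, h₃]
      omega
    have h₁ := key true
    have h₂ := key false
    have h₃ := θ.plus_minus
    have h₄ := γ.plus_minus
    have h₅ := β.plus_minus
    omega

section substitute

variable {θ : Clan r s} {γ : Clan p q} {ι : Fin (p + q) → Fin (r + s)}
  {hι : Function.Injective ι} {h : Restricts θ γ ι}

theorem substitute_restricts (β : Clan p q) : Restricts (substitute θ γ ι hι h β) β ι :=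
  fun _ => ⟨hι.extend_apply _ _ _, hι.extend_apply _ _ _⟩

theorem substitute_agreesWithOutside (β : Clan p q) :
    AgreesWithOutside (substitute θ γ ι hι h β) θ ι := fun m hm =>
  have hm' : ¬ ∃ k, ι k = m := by simpa using hm
  ⟨Function.extend_apply' _ _ m hm', Function.extend_apply' _ _ m hm'⟩

theorem eq_substitute {φ : Clan r s} {β : Clan p q} (hφ : Restricts φ β ι)
    (hout : AgreesWithOutside φ θ ι) : φ = substitute θ γ ι hι h β := by
  have key : ∀ m, φ.mate m = (substitute θ γ ι hι h β).mate m ∧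
      φ.sign m = (substitute θ γ ι hι h β).sign m := by
    intro m
    by_cases hm : ∃ k, ι k = m
    · obtain ⟨k, rfl⟩ := hm
      rw [(hφ k).1, (hφ k).2, (substitute_restricts β k).1, (substitute_restricts β k).2]
      exact ⟨rfl, rfl⟩
    · push Not at hm
      rw [(hout m hm).1, (hout m hm).2, (substitute_agreesWithOutside β m hm).1,
        (substitute_agreesWithOutside β m hm).2]
      exact ⟨rfl, rfl⟩
  exact eq_of_mate_sign (funext fun m => (key m).1) (funext fun m => (key m).2)

theorem Transposition.substitute (hmono : StrictMono ι) {β β' : Clan p q}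
    (ht : Transposition β β') :
    Transposition (substitute θ γ ι hι h β) (substitute θ γ ι hι h β') := by
  have plus : ∀ (c : Clan p q) k, c.IsPlus k → (Clan.substitute θ γ ι hι h c).IsPlus (ι k) :=
    fun c k hk => ⟨by rw [(substitute_restricts c k).1, hk.1],
      by rw [(substitute_restricts c k).2, hk.2]⟩
  have minus : ∀ (c : Clan p q) k, c.IsMinus k → (Clan.substitute θ γ ι hι h c).IsMinus (ι k) :=
    fun c k hk => ⟨by rw [(substitute_restricts c k).1, hk.1],
      by rw [(substitute_restricts c k).2, hk.2]⟩
  have mtch : ∀ (c : Clan p q) k l, c.IsMatch k l →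
      (Clan.substitute θ γ ι hι h c).IsMatch (ι k) (ι l) :=
    fun c k l hk => ⟨hmono hk.1, by rw [(substitute_restricts c k).1, hk.2]⟩
  have out : ∀ S : Set (Fin (p + q)), AgreeOutside β β' S →
      AgreeOutside (Clan.substitute θ γ ι hι h β) (Clan.substitute θ γ ι hι h β') (ι '' S) := by
    intro S hS m hm
    by_cases hk : ∃ k, ι k = m
    · obtain ⟨k, rfl⟩ := hk
      have hkS := hS k fun hk => hm ⟨k, hk, rfl⟩
      rw [(substitute_restricts β k).1, (substitute_restricts β k).2,
        (substitute_restricts β' k).1, (substitute_restricts β' k).2, hkS.1, hkS.2]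
      exact ⟨rfl, rfl⟩
    · push Not at hk
      rw [(substitute_agreesWithOutside β m hk).1, (substitute_agreesWithOutside β m hk).2,
        (substitute_agreesWithOutside β' m hk).1, (substitute_agreesWithOutside β' m hk).2]
      exact ⟨rfl, rfl⟩
  simp only [Transposition] at ht ⊢
  rcases ht with ⟨a, b, h₁, h₂, h₃, h₄, h₅⟩ | ⟨a, b, h₁, h₂, h₃, h₄, h₅⟩ |
    ⟨a, b, d, h₁, h₂, h₃, h₄, h₅, h₆⟩ | ⟨a, b, d, h₁, h₂, h₃, h₄, h₅, h₆⟩ |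
    ⟨a, b, d, h₁, h₂, h₃, h₄, h₅, h₆⟩ | ⟨a, b, d, h₁, h₂, h₃, h₄, h₅, h₆⟩ |
    ⟨i, j, k, l, h₁, h₂, h₃, h₄, h₅, h₆⟩ | ⟨i, j, k, l, h₁, h₂, h₃, h₄, h₅, h₆, h₇⟩ |
    ⟨i, j, k, l, h₁, h₂, h₃, h₄, h₅, h₆, h₇⟩ | ⟨i, j, k, l, h₁, h₂, h₃, h₄, h₅, h₆, h₇, h₈⟩
  · refine .inl ⟨ι a, ι b, hmono h₁, plus _ _ h₂, minus _ _ h₃, mtch _ _ _ h₄, ?_⟩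
    simpa [Set.image_insert_eq] using out _ h₅
  · refine .inr <| .inl ⟨ι a, ι b, hmono h₁, minus _ _ h₂, plus _ _ h₃, mtch _ _ _ h₄, ?_⟩
    simpa [Set.image_insert_eq] using out _ h₅
  · refine .inr <| .inr <| .inl ⟨ι a, ι b, ι d, mtch _ _ _ h₁, hmono h₂, plus _ _ h₃,
      mtch _ _ _ h₄, plus _ _ h₅, ?_⟩
    simpa [Set.image_insert_eq] using out _ h₆
  · refine .inr <| .inr <| .inr <| .inl ⟨ι a, ι b, ι d, mtch _ _ _ h₁, hmono h₂, minus _ _ h₃,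
      mtch _ _ _ h₄, minus _ _ h₅, ?_⟩
    simpa [Set.image_insert_eq] using out _ h₆
  · refine .inr <| .inr <| .inr <| .inr <| .inl ⟨ι a, ι b, ι d, plus _ _ h₁, hmono h₂,
      mtch _ _ _ h₃, mtch _ _ _ h₄, plus _ _ h₅, ?_⟩
    simpa [Set.image_insert_eq] using out _ h₆
  · refine .inr <| .inr <| .inr <| .inr <| .inr <| .inl ⟨ι a, ι b, ι d, minus _ _ h₁, hmono h₂,
      mtch _ _ _ h₃, mtch _ _ _ h₄, minus _ _ h₅, ?_⟩
    simpa [Set.image_insert_eq] using out _ h₆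
  · refine .inr <| .inr <| .inr <| .inr <| .inr <| .inr <| .inl ⟨ι i, ι j, ι k, ι l,
      mtch _ _ _ h₁, hmono h₂, mtch _ _ _ h₃, mtch _ _ _ h₄, mtch _ _ _ h₅, ?_⟩
    simpa [Set.image_insert_eq] using out _ h₆
  · refine .inr <| .inr <| .inr <| .inr <| .inr <| .inr <| .inr <| .inl ⟨ι i, ι j, ι k, ι l,
      mtch _ _ _ h₁, hmono h₂, mtch _ _ _ h₃, mtch _ _ _ h₄, plus _ _ h₅, minus _ _ h₆, ?_⟩
    simpa [Set.image_insert_eq] using out _ h₇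
  · refine .inr <| .inr <| .inr <| .inr <| .inr <| .inr <| .inr <| .inr <| .inl
      ⟨ι i, ι j, ι k, ι l, mtch _ _ _ h₁, hmono h₂, mtch _ _ _ h₃, mtch _ _ _ h₄,
        minus _ _ h₅, plus _ _ h₆, ?_⟩
    simpa [Set.image_insert_eq] using out _ h₇
  · refine .inr <| .inr <| .inr <| .inr <| .inr <| .inr <| .inr <| .inr <| .inr
      ⟨ι i, ι j, ι k, ι l, hmono h₁, hmono h₂, hmono h₃, mtch _ _ _ h₄, mtch _ _ _ h₅,
        mtch _ _ _ h₆, mtch _ _ _ h₇, ?_⟩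
    simpa [Set.image_insert_eq] using out _ h₈

end substitute

/-- Contribution to the length of an ordered pair of positions `a`, `x` with mates `a'`, `x'`. -/
def pairTerm {α : Type*} [LinearOrder α] (a a' x x' : α) : ℤ :=
  (if a < x ∧ x < a' then 1 else 0) - (if x < a ∧ a < x' ∧ x' < a' then 1 else 0)

theorem len_eq_sum_pairTerm (c : Clan p q) :
    c.len = ∑ i, (if i < c.mate i then 1 else 0) +
      ∑ i, ∑ x, pairTerm i (c.mate i) x (c.mate x) := by
  have hcross : ∀ a b : Fin (p + q), ((Finset.univ.filter
      (fun st : Fin (p + q) × Fin (p + q) =>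
        c.IsMatch st.1 st.2 ∧ st.1 < a ∧ a < st.2 ∧ st.2 < b)).card : ℤ) =
      ∑ x, if x < a ∧ a < c.mate x ∧ c.mate x < b then 1 else 0 := by
    intro a b
    rw [Finset.card_filter, Fintype.sum_prod_type]
    push_cast
    refine Finset.sum_congr rfl fun x _ => ?_
    rw [Finset.sum_eq_single (c.mate x)]
    · simp only [IsMatch]
      refine if_congr ?_ rfl rfl
      constructor
      · rintro ⟨-, h⟩; exact h
      · rintro h; exact ⟨⟨h.1.trans h.2.1, trivial⟩, h⟩
    · intro y _ hy
      simp [IsMatch, hy.symm]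
    · simp
  rw [len, Finset.sum_filter, Fintype.sum_prod_type, ← Finset.sum_add_distrib]
  refine Finset.sum_congr rfl fun i _ => ?_
  rw [Finset.sum_eq_single (c.mate i)]
  · simp only [IsMatch, and_true, pairTerm, Finset.sum_sub_distrib]
    simp only [IsMatch] at hcross
    simp only [hcross]
    split_ifs with hi
    · have hcard : (∑ x, if i < x ∧ x < c.mate i then (1 : ℤ) else 0) =
          ((c.mate i : ℕ) : ℤ) - ((i : ℕ) : ℤ) - 1 := by
        have := Fin.card_Ioo i (c.mate i)
        have hset : (Finset.univ.filter fun x => i < x ∧ x < c.mate i) =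
            Finset.Ioo i (c.mate i) := by ext; simp
        rw [Finset.sum_boole, hset, this]
        have : (i : ℕ) < c.mate i := hi
        omega
      rw [hcard]
      ring
    · have h₁ : ∀ x, ¬ (i < x ∧ x < c.mate i) := fun x hx => hi (hx.1.trans hx.2)
      simp [h₁]
  · intro y _ hy
    simp [IsMatch, hy.symm]
  · simp

/-- Under a transposition, the number of matchings with left end in a lower set `P` and
right end in a disjoint upper set `Q` does not decrease. -/
theorem Transposition.sum_le {β β' : Clan p q} (ht : Transposition β β')
    {P Q : Fin (p + q) → Prop} [DecidablePred P] [DecidablePred Q]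
    (hP : ∀ a b, a < b → P b → P a)
    (hQ : ∀ a b, a < b → Q a → Q b) (hPQ : ∀ a, P a → ¬ Q a) :
    ∑ i, (if P i ∧ Q (β.mate i) then (1 : ℤ) else 0) ≤
      ∑ i, (if P i ∧ Q (β'.mate i) then (1 : ℤ) else 0) := by
  have hPQ' : ∀ a b, a < b → P b → ¬ Q a := fun a b hab hb => hPQ a (hP a b hab hb)
  have red : ∀ S : Finset (Fin (p + q)), AgreeOutside β β' S →
      ∑ i ∈ S, (if P i ∧ Q (β.mate i) then (1 : ℤ) else 0) ≤
        ∑ i ∈ S, (if P i ∧ Q (β'.mate i) then (1 : ℤ) else 0) →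
      ∑ i, (if P i ∧ Q (β.mate i) then (1 : ℤ) else 0) ≤
        ∑ i, (if P i ∧ Q (β'.mate i) then (1 : ℤ) else 0) := by
    intro S hS hle
    rw [← Finset.sum_add_sum_compl S, ← Finset.sum_add_sum_compl S
      (fun i => if P i ∧ Q (β'.mate i) then (1 : ℤ) else 0)]
    refine add_le_add hle (le_of_eq ?_)
    refine Finset.sum_congr rfl fun i hi => ?_
    rw [(hS i (by simpa using hi)).1]
  have swap : ∀ {c : Clan p q} {a b}, c.IsMatch a b → a < b ∧ c.mate a = b ∧ c.mate b = a :=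
    fun h => ⟨h.1, h.2, by rw [← h.2, Clan.mate_invol]⟩
  have pair : ∀ a b, a < b → β.mate a = a → β.mate b = b → β'.IsMatch a b →
      AgreeOutside β β' {a, b} →
      ∑ i, (if P i ∧ Q (β.mate i) then (1 : ℤ) else 0) ≤
        ∑ i, (if P i ∧ Q (β'.mate i) then (1 : ℤ) else 0) := by
    intro a b hab ha hb hm ho
    refine red {a, b} (by simpa using ho) ?_
    obtain ⟨-, hm₁, hm₂⟩ := swap hm
    rw [Finset.sum_pair hab.ne, Finset.sum_pair hab.ne, ha, hb, hm₁, hm₂]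
    grind
  have triple : ∀ a b d, a < b → b < d → AgreeOutside β β' {a, b, d} →
      (β.IsMatch a b ∧ β.mate d = d ∨ β.mate a = a ∧ β.IsMatch b d) → β'.IsMatch a d →
      β'.mate b = b → ∑ i, (if P i ∧ Q (β.mate i) then (1 : ℤ) else 0) ≤
        ∑ i, (if P i ∧ Q (β'.mate i) then (1 : ℤ) else 0) := by
    intro a b d hab hbd ho hm hm' hb
    refine red {a, b, d} (by simpa using ho) ?_
    have had := hab.trans hbd
    obtain ⟨-, hm₁, hm₂⟩ := swap hm'
    rw [Finset.sum_insert (by simp [hab.ne, had.ne]), Finset.sum_pair hbd.ne,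
      Finset.sum_insert (by simp [hab.ne, had.ne]), Finset.sum_pair hbd.ne, hm₁, hm₂, hb]
    rcases hm with ⟨hm, hd⟩ | ⟨ha, hm⟩
    · obtain ⟨-, hm₃, hm₄⟩ := swap hm
      rw [hm₃, hm₄, hd]
      grind
    · obtain ⟨-, hm₃, hm₄⟩ := swap hm
      rw [hm₃, hm₄, ha]
      grind
  have quad : ∀ i j k l, i < j → j < k → k < l → AgreeOutside β β' {i, j, k, l} →
      (β.IsMatch i j ∧ β.IsMatch k l ∧ (β'.IsMatch i k ∧ β'.IsMatch j l ∨
        β'.IsMatch i l ∧ β'.mate j = j ∧ β'.mate k = k) ∨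
      β.IsMatch i k ∧ β.IsMatch j l ∧ β'.IsMatch i l ∧ β'.IsMatch j k) →
      ∑ i, (if P i ∧ Q (β.mate i) then (1 : ℤ) else 0) ≤
        ∑ i, (if P i ∧ Q (β'.mate i) then (1 : ℤ) else 0) := by
    intro i j k l hij hjk hkl ho hm
    refine red {i, j, k, l} (by simpa using ho) ?_
    have hik := hij.trans hjk
    have hjl := hjk.trans hkl
    have hil := hij.trans hjl
    rw [Finset.sum_insert (by simp [hij.ne, hik.ne, hil.ne]),
      Finset.sum_insert (by simp [hjk.ne, hjl.ne]), Finset.sum_pair hkl.ne,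
      Finset.sum_insert (by simp [hij.ne, hik.ne, hil.ne]),
      Finset.sum_insert (by simp [hjk.ne, hjl.ne]), Finset.sum_pair hkl.ne]
    rcases hm with ⟨h₁, h₂, ⟨h₃, h₄⟩ | ⟨h₃, h₄, h₅⟩⟩ | ⟨h₁, h₂, h₃, h₄⟩
    · obtain ⟨-, h₁, h₁'⟩ := swap h₁
      obtain ⟨-, h₂, h₂'⟩ := swap h₂
      obtain ⟨-, h₃, h₃'⟩ := swap h₃
      obtain ⟨-, h₄, h₄'⟩ := swap h₄
      rw [h₁, h₁', h₂, h₂', h₃, h₃', h₄, h₄']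
      grind
    · obtain ⟨-, h₁, h₁'⟩ := swap h₁
      obtain ⟨-, h₂, h₂'⟩ := swap h₂
      obtain ⟨-, h₃, h₃'⟩ := swap h₃
      rw [h₁, h₁', h₂, h₂', h₃, h₃', h₄, h₅]
      grind
    · obtain ⟨-, h₁, h₁'⟩ := swap h₁
      obtain ⟨-, h₂, h₂'⟩ := swap h₂
      obtain ⟨-, h₃, h₃'⟩ := swap h₃
      obtain ⟨-, h₄, h₄'⟩ := swap h₄
      rw [h₁, h₁', h₂, h₂', h₃, h₃', h₄, h₄']
      grind
  rcases ht with ⟨a, b, h₁, h₂, h₃, h₄, h₅⟩ | ⟨a, b, h₁, h₂, h₃, h₄, h₅⟩ |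
    ⟨a, b, d, h₁, h₂, h₃, h₄, h₅, h₆⟩ | ⟨a, b, d, h₁, h₂, h₃, h₄, h₅, h₆⟩ |
    ⟨a, b, d, h₁, h₂, h₃, h₄, h₅, h₆⟩ | ⟨a, b, d, h₁, h₂, h₃, h₄, h₅, h₆⟩ |
    ⟨i, j, k, l, h₁, h₂, h₃, h₄, h₅, h₆⟩ | ⟨i, j, k, l, h₁, h₂, h₃, h₄, h₅, h₆, h₇⟩ |
    ⟨i, j, k, l, h₁, h₂, h₃, h₄, h₅, h₆, h₇⟩ | ⟨i, j, k, l, h₁, h₂, h₃, h₄, h₅, h₆, h₇, h₈⟩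
  · exact pair a b h₁ h₂.1 h₃.1 h₄ h₅
  · exact pair a b h₁ h₂.1 h₃.1 h₄ h₅
  · exact triple a b d h₁.1 h₂ h₆ (.inl ⟨h₁, h₃.1⟩) h₄ h₅.1
  · exact triple a b d h₁.1 h₂ h₆ (.inl ⟨h₁, h₃.1⟩) h₄ h₅.1
  · exact triple a b d h₂ h₃.1 h₆ (.inr ⟨h₁.1, h₃⟩) h₄ h₅.1
  · exact triple a b d h₂ h₃.1 h₆ (.inr ⟨h₁.1, h₃⟩) h₄ h₅.1
  · exact quad i j k l h₁.1 h₂ h₃.1 h₆ (.inl ⟨h₁, h₃, .inl ⟨h₄, h₅⟩⟩)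
  · exact quad i j k l h₁.1 h₂ h₃.1 h₇ (.inl ⟨h₁, h₃, .inr ⟨h₄, h₅.1, h₆.1⟩⟩)
  · exact quad i j k l h₁.1 h₂ h₃.1 h₇ (.inl ⟨h₁, h₃, .inr ⟨h₄, h₅.1, h₆.1⟩⟩)
  · exact quad i j k l h₁ h₂ h₃ h₈ (.inr ⟨h₄, h₅, h₆, h₇⟩)

/-- The complement of the range of `ι`, as a finset. -/
def offRange (ι : Fin (p + q) → Fin (r + s)) : Finset (Fin (r + s)) :=
  Finset.univ.filter fun x => ∀ k, ι k ≠ x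

/-- The part of the length of a clan `φ` agreeing with `θ` off the range of `ι` that does not
depend on the restriction of `φ` along `ι`. -/
def lenConst (θ : Clan r s) (ι : Fin (p + q) → Fin (r + s)) : ℤ :=
  ∑ i ∈ offRange ι, (if i < θ.mate i then 1 else 0) +
    ∑ i ∈ offRange ι, ∑ x ∈ offRange ι, pairTerm i (θ.mate i) x (θ.mate x) +
    ∑ x ∈ offRange ι, ∑ k, (if x < ι k ∧ ι k < θ.mate x then 1 else 0)

/-- For each `x` off the range of `ι`, the number of matchings of `β` whose image under `ι`
surrounds both `x` and its mate in `θ`. -/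
def coverCount (θ : Clan r s) (ι : Fin (p + q) → Fin (r + s)) (β : Clan p q) : ℤ :=
  ∑ x ∈ offRange ι, ∑ k,
    (if (ι k < x ∧ ι k < θ.mate x) ∧ (x < ι (β.mate k) ∧ θ.mate x < ι (β.mate k))
      then 1 else 0)

theorem Transposition.coverCount_le {β β' : Clan p q} (ht : Transposition β β')
    (θ : Clan r s) {ι : Fin (p + q) → Fin (r + s)} (hι : StrictMono ι) :
    coverCount θ ι β ≤ coverCount θ ι β' := by
  refine Finset.sum_le_sum fun x _ => ?_
  exact ht.sum_le (P := fun k => ι k < x ∧ ι k < θ.mate x)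
    (Q := fun k => x < ι k ∧ θ.mate x < ι k)
    (fun a b hab h => ⟨(hι hab).trans h.1, (hι hab).trans h.2⟩)
    (fun a b hab h => ⟨h.1.trans (hι hab), h.2.trans (hι hab)⟩)
    (fun a h h' => lt_asymm h.1 h'.1)

theorem ble.coverCount_le {β β' : Clan p q} (hb : ble β β')
    (θ : Clan r s) {ι : Fin (p + q) → Fin (r + s)} (hι : StrictMono ι) :
    coverCount θ ι β ≤ coverCount θ ι β' := by
  induction hb with
  | refl => exact le_rfl
  | tail _ ht ih => exact ih.trans (ht.coverCount_le θ hι)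

theorem len_eq_len_add {θ φ : Clan r s} {β γ : Clan p q} {ι : Fin (p + q) → Fin (r + s)}
    (hι : StrictMono ι) (hθ : Restricts θ γ ι) (hφ : Restricts φ β ι)
    (hout : AgreesWithOutside φ θ ι) :
    φ.len = β.len + lenConst θ ι + coverCount θ ι β := by
  have hoff : ∀ x ∈ offRange ι, φ.mate x = θ.mate x := fun x hx =>
    (hout x (by simpa [offRange] using hx)).1
  have split : ∀ F : Fin (r + s) → ℤ, ∑ x, F x = ∑ k, F (ι k) + ∑ x ∈ offRange ι, F x :=
    fun F => sum_eq_sum_comp_add_sum_compl hι.injective F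
  have hinv : ∀ F : Fin (r + s) → Fin (r + s) → ℤ,
      ∑ x ∈ offRange ι, F x (θ.mate x) = ∑ x ∈ offRange ι, F (θ.mate x) x := by
    intro F
    refine Finset.sum_bij' (fun x _ => θ.mate x) (fun x _ => θ.mate x) ?_ ?_ ?_ ?_ ?_
    · intro x hx
      simpa [offRange] using hθ.mate_notMem_range (by simpa [offRange] using hx)
    · intro x hx
      simpa [offRange] using hθ.mate_notMem_range (by simpa [offRange] using hx)
    · intro x _
      exact θ.mate_invol x
    · intro x _
      exact θ.mate_invol x
    · intro x _
      rw [θ.mate_invol]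
  have hcross : (∑ k, ∑ x ∈ offRange ι, pairTerm (ι k) (ι (β.mate k)) x (θ.mate x)) +
      (∑ x ∈ offRange ι, ∑ k, pairTerm x (θ.mate x) (ι k) (ι (β.mate k))) =
      (∑ x ∈ offRange ι, ∑ k, (if x < ι k ∧ ι k < θ.mate x then 1 else 0)) +
        coverCount θ ι β := by
    have h₁ : ∀ k, ∑ x ∈ offRange ι, pairTerm (ι k) (ι (β.mate k)) x (θ.mate x) =
        ∑ x ∈ offRange ι, ((if ι k < x ∧ x < ι (β.mate k) then 1 else 0) -
          (if θ.mate x < ι k ∧ ι k < x ∧ x < ι (β.mate k) then 1 else 0)) := by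
      intro k
      simp only [pairTerm, Finset.sum_sub_distrib]
      rw [hinv fun x y => if x < ι k ∧ ι k < y ∧ y < ι (β.mate k) then 1 else 0]
    simp only [h₁]
    rw [Finset.sum_comm, coverCount, ← Finset.sum_add_distrib, ← Finset.sum_add_distrib]
    refine Finset.sum_congr rfl fun x hx => ?_
    rw [← Finset.sum_add_distrib, ← Finset.sum_add_distrib]
    refine Finset.sum_congr rfl fun k _ => ?_
    have hx' : ∀ k, ι k ≠ x := by simpa [offRange] using hx
    have hy' := hθ.mate_notMem_range hx'
    have e₁ := hx' k
    have e₂ := hx' (β.mate k)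
    have e₃ := hy' k
    have e₄ := hy' (β.mate k)
    simp only [pairTerm]
    generalize ι k = a at *
    generalize ι (β.mate k) = a' at *
    generalize θ.mate x = x' at *
    grind
  have e₁ : ∑ i ∈ offRange ι, (if i < φ.mate i then (1 : ℤ) else 0) =
      ∑ i ∈ offRange ι, (if i < θ.mate i then (1 : ℤ) else 0) :=
    Finset.sum_congr rfl fun i hi => by rw [hoff i hi]
  have e₂ : ∑ i ∈ offRange ι, ∑ x ∈ offRange ι, pairTerm i (φ.mate i) x (φ.mate x) =
      ∑ i ∈ offRange ι, ∑ x ∈ offRange ι, pairTerm i (θ.mate i) x (θ.mate x) :=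
    Finset.sum_congr rfl fun i hi => Finset.sum_congr rfl fun x hx => by
      rw [hoff i hi, hoff x hx]
  have e₃ : (∑ k, ∑ x ∈ offRange ι, pairTerm (ι k) (ι (β.mate k)) x (φ.mate x)) =
      ∑ k, ∑ x ∈ offRange ι, pairTerm (ι k) (ι (β.mate k)) x (θ.mate x) :=
    Finset.sum_congr rfl fun k _ => Finset.sum_congr rfl fun x hx => by rw [hoff x hx]
  have e₄ : (∑ x ∈ offRange ι, ∑ k, pairTerm x (φ.mate x) (ι k) (ι (β.mate k))) =
      ∑ x ∈ offRange ι, ∑ k, pairTerm x (θ.mate x) (ι k) (ι (β.mate k)) :=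
    Finset.sum_congr rfl fun x hx => by rw [hoff x hx]
  have e₅ : ∀ k l, pairTerm (ι k) (ι (β.mate k)) (ι l) (ι (β.mate l)) =
      pairTerm k (β.mate k) l (β.mate l) := by
    intro k l
    simp only [pairTerm, hι.lt_iff_lt]
  rw [len_eq_sum_pairTerm, len_eq_sum_pairTerm, lenConst, split, split]
  simp only [split, Finset.sum_add_distrib, (hφ _).1, e₁, e₂, e₃, e₄, e₅, hι.lt_iff_lt]
  linarith

end Clan

/-- given an interval pattern embedding of `[α,γ]` into `[Φ(α),θ]`,
if `α ⋖ α' ≤ γ` then `Φ(α) ⋖ Φ(α') ≤ θ`. -/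
theorem interval_embed_covers {p q r s : ℕ} (α α' γ : Clan p q) (θ φα φα' : Clan r s)
    (ι : Fin (p + q) → Fin (r + s))
    (hαγ : Clan.ble α γ)
    (hθγ : Clan.Pattern θ γ ι)
    (hφα : Clan.Pattern φα α ι)
    (hout : Clan.AgreesWithOutside φα θ ι)
    (hlen : θ.len - φα.len = γ.len - α.len)
    (hcov : Clan.Covers α α') (hα'γ : Clan.ble α' γ)
    (hφα' : Clan.Pattern φα' α' ι)
    (hout' : Clan.AgreesWithOutside φα' θ ι) :
    Clan.Covers φα φα' ∧ Clan.ble φα' θ := by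
  have hι := hθγ.1
  have hθ := hθγ.restricts
  have lift : ∀ β β' : Clan p q, Clan.Transposition β β' → Clan.Transposition
      (Clan.substitute θ γ ι hι.injective hθ β) (Clan.substitute θ γ ι hι.injective hθ β') :=
    fun _ _ ht => ht.substitute hι
  have hlenα := Clan.len_eq_len_add hι hθ hφα.restricts hout
  have hlenα' := Clan.len_eq_len_add hι hθ hφα'.restricts hout'
  have hlenγ := Clan.len_eq_len_add hι hθ hθ (fun _ _ => ⟨rfl, rfl⟩)
  have hle : Clan.ble α α' := hcov.1.to_reflTransGen
  have hle₁ := hle.coverCount_le θ hι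
  have hle₂ := hα'γ.coverCount_le θ hι
  have hlen' := hcov.2
  refine ⟨⟨?_, by omega⟩, ?_⟩
  · rw [Clan.eq_substitute (hι := hι.injective) (h := hθ) hφα.restricts hout,
      Clan.eq_substitute (hι := hι.injective) (h := hθ) hφα'.restricts hout']
    exact hcov.1.lift _ lift
  · rw [Clan.eq_substitute (hι := hι.injective) (h := hθ) hφα'.restricts hout']
    have hγ : Clan.ble (Clan.substitute θ γ ι hι.injective hθ α')
        (Clan.substitute θ γ ι hι.injective hθ γ) := hα'γ.lift _ lift
    rwa [← Clan.eq_substitute (φ := θ) hθ (fun _ _ => ⟨rfl, rfl⟩)] at hγ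
end
end
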